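/- arXiv:math/0210129 — 4 statements merged into one kernel-verified Lean document; each statement's English description precedes it below -/
import Mathlib

section
/- Let (R, m, K) be a Noetherian local ring, let M be a finitely generated R-module, and let P be an ideal of R such that the quotient ring R/P is a regular local ring. Then M has finite projective dimension over R if and only if there exists an integer n₀ such that Tor_i^R(M, R/P) = 0 for all i ≥ n₀. -/
open CategoryTheory

noncomputable section

set_option maxHeartbeats 1000000
set_option synthInstance.maxHeartbeats 400000

/-- A module has finite projective dimension iff it admits a projective resolution that
vanishes in all sufficiently large degrees. -/
def HasFiniteProjectiveDimension (R : Type) [Ring R] (M : Type) [AddCommGroup M]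
    [Module R M] : Prop :=
  ∃ (n : ℕ) (P : ProjectiveResolution (ModuleCat.of R M)),
    ∀ i > n, Limits.IsZero (P.complex.X i)

/-- `Tor_i^R(M, N)`. -/
noncomputable def TorMod (R : Type) [CommRing R] (i : ℕ) (M N : Type) [AddCommGroup M]
    [Module R M] [AddCommGroup N] [Module R N] : ModuleCat R :=
  ((Tor (ModuleCat R) i).obj (ModuleCat.of R M)).obj (ModuleCat.of R N)

/-- A (Noetherian) local ring is regular if its maximal ideal is generated by
(Krull dimension)-many elements. -/
def IsRegularLocal (R : Type) [CommRing R] [IsLocalRing R] : Prop :=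
  IsNoetherianRing R ∧
  ∃ (n : ℕ) (x : Fin n → R), Ideal.span (Set.range x) = IsLocalRing.maximalIdeal R ∧
    ringKrullDim R = n

section TensorExactness

open Function LinearMap TensorProduct

variable {R : Type*} [CommRing R]
  {L F M : Type*} [AddCommGroup L] [Module R L] [AddCommGroup F] [Module R F]
  [AddCommGroup M] [Module R M] {ι : L →ₗ[R] F} {π : F →ₗ[R] M}

theorem rTensor_lTensor_comm {A B C D : Type*} [AddCommGroup A] [Module R A] [AddCommGroup B]
    [Module R B] [AddCommGroup C] [Module R C] [AddCommGroup D] [Module R D]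
    (f : A →ₗ[R] B) (g : C →ₗ[R] D) (x : A ⊗[R] C) :
    f.rTensor D (g.lTensor A x) = g.lTensor B (f.rTensor C x) := by
  rw [← LinearMap.comp_apply, ← LinearMap.comp_apply, rTensor_comp_lTensor, lTensor_comp_rTensor]

theorem lTensor_lTensor_eq_zero {A B C : Type*} (D : Type*) [AddCommGroup A] [Module R A]
    [AddCommGroup B] [Module R B] [AddCommGroup C] [Module R C] [AddCommGroup D] [Module R D]
    {f : A →ₗ[R] B} {g : B →ₗ[R] C} (h : Exact f g) (x : D ⊗[R] A) :
    g.lTensor D (f.lTensor D x) = 0 := by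
  rw [← LinearMap.comp_apply, ← lTensor_comp, h.linearMap_comp_eq_zero, lTensor_zero,
    LinearMap.zero_apply]

theorem rTensor_rTensor_eq_zero {A B C : Type*} (D : Type*) [AddCommGroup A] [Module R A]
    [AddCommGroup B] [Module R B] [AddCommGroup C] [Module R C] [AddCommGroup D] [Module R D]
    {f : A →ₗ[R] B} {g : B →ₗ[R] C} (h : Exact f g) (x : A ⊗[R] D) :
    g.rTensor D (f.rTensor D x) = 0 := by
  rw [← LinearMap.comp_apply, ← rTensor_comp, h.linearMap_comp_eq_zero, rTensor_zero,
    LinearMap.zero_apply]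

/-- Dimension shifting: for `0 → L → F → M → 0` exact with `F` flat and a sequence
`Q₃ → Q₂ → Q₁ → Q₀`, exactness of `L ⊗ Q` at `Q₁` implies exactness of `M ⊗ Q` at `Q₂`. -/
theorem exact_lTensor_of_exact_lTensor_syzygy {Q₃ Q₂ Q₁ Q₀ : Type*}
    [AddCommGroup Q₃] [Module R Q₃] [AddCommGroup Q₂] [Module R Q₂]
    [AddCommGroup Q₁] [Module R Q₁] [AddCommGroup Q₀] [Module R Q₀]
    {d₃ : Q₃ →ₗ[R] Q₂} {d₂ : Q₂ →ₗ[R] Q₁} {d₁ : Q₁ →ₗ[R] Q₀}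
    [Module.Flat R F] [Module.Flat R Q₀]
    (hι : Injective ι) (hex : Exact ι π) (hπ : Surjective π)
    (h₂ : Exact d₃ d₂) (h₁ : Exact d₂ d₁)
    (hL : Exact (d₂.lTensor L) (d₁.lTensor L)) :
    Exact (d₃.lTensor M) (d₂.lTensor M) := by
  refine LinearMap.exact_of_comp_of_mem_range ?_ fun m hm ↦ ?_
  · rw [← lTensor_comp, h₂.linearMap_comp_eq_zero, lTensor_zero]
  obtain ⟨f, rfl⟩ := rTensor_surjective Q₂ hπ m
  rw [← rTensor_lTensor_comm] at hm
  obtain ⟨l, hl⟩ := (rTensor_exact Q₁ hex hπ _).1 hm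
  have hl0 : d₁.lTensor L l = 0 := by
    apply Module.Flat.rTensor_preserves_injective_linearMap (M := Q₀) ι hι
    rw [rTensor_lTensor_comm, hl, map_zero, lTensor_lTensor_eq_zero _ h₁]
  obtain ⟨w, rfl⟩ := (hL _).1 hl0
  rw [rTensor_lTensor_comm] at hl
  obtain ⟨v, hv⟩ := (Module.Flat.lTensor_exact F h₂ (f - ι.rTensor Q₂ w)).1
    (by rw [map_sub, hl, sub_self])
  refine ⟨π.rTensor Q₃ v, ?_⟩
  rw [← rTensor_lTensor_comm, hv, map_sub, sub_eq_self, rTensor_rTensor_eq_zero _ hex]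

/-- The converse of `exact_lTensor_of_exact_lTensor_syzygy`. -/
theorem exact_lTensor_syzygy_of_exact_lTensor {Q₃ Q₂ Q₁ Q₀ : Type*}
    [AddCommGroup Q₃] [Module R Q₃] [AddCommGroup Q₂] [Module R Q₂]
    [AddCommGroup Q₁] [Module R Q₁] [AddCommGroup Q₀] [Module R Q₀]
    {d₃ : Q₃ →ₗ[R] Q₂} {d₂ : Q₂ →ₗ[R] Q₁} {d₁ : Q₁ →ₗ[R] Q₀}
    [Module.Flat R F] [Module.Flat R Q₁]
    (hι : Injective ι) (hex : Exact ι π) (hπ : Surjective π)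
    (h₂ : Exact d₃ d₂) (h₁ : Exact d₂ d₁)
    (hM : Exact (d₃.lTensor M) (d₂.lTensor M)) :
    Exact (d₂.lTensor L) (d₁.lTensor L) := by
  refine LinearMap.exact_of_comp_of_mem_range ?_ fun x hx ↦ ?_
  · rw [← lTensor_comp, h₁.linearMap_comp_eq_zero, lTensor_zero]
  obtain ⟨y, hy⟩ := (Module.Flat.lTensor_exact F h₁ (ι.rTensor Q₁ x)).1
    (by rw [← rTensor_lTensor_comm, hx, map_zero])
  obtain ⟨z, hz⟩ := (hM (π.rTensor Q₂ y)).1 (by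
    rw [← rTensor_lTensor_comm, hy, rTensor_rTensor_eq_zero _ hex])
  obtain ⟨f, rfl⟩ := rTensor_surjective Q₃ hπ z
  obtain ⟨w, hw⟩ := (rTensor_exact Q₂ hex hπ (y - d₃.lTensor F f)).1
    (by rw [map_sub, rTensor_lTensor_comm, hz, sub_self])
  refine ⟨w, Module.Flat.rTensor_preserves_injective_linearMap (M := Q₁) ι hι ?_⟩
  rw [rTensor_lTensor_comm, hw, map_sub, hy, sub_eq_self, lTensor_lTensor_eq_zero _ h₂]

/-- For `0 → L → F → M → 0` exact and a flat presentation `Q₂ → Q₁ → Q₀ → N → 0`, exactness of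
`M ⊗ Q₂ → M ⊗ Q₁ → M ⊗ Q₀` implies injectivity of `L ⊗ N → F ⊗ N`. -/
theorem rTensor_injective_of_exact_lTensor {Q₂ Q₁ Q₀ N : Type*}
    [AddCommGroup Q₂] [Module R Q₂] [AddCommGroup Q₁] [Module R Q₁]
    [AddCommGroup Q₀] [Module R Q₀] [AddCommGroup N] [Module R N]
    {d₂ : Q₂ →ₗ[R] Q₁} {d₁ : Q₁ →ₗ[R] Q₀} {ε : Q₀ →ₗ[R] N} [Module.Flat R Q₀]
    (hι : Injective ι) (hex : Exact ι π) (hπ : Surjective π)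
    (h₁ : Exact d₂ d₁) (h₀ : Exact d₁ ε) (hε : Surjective ε)
    (hM : Exact (d₂.lTensor M) (d₁.lTensor M)) :
    Injective (ι.rTensor N) := by
  rw [injective_iff_map_eq_zero]
  intro z hz
  obtain ⟨x, rfl⟩ := lTensor_surjective L hε z
  rw [rTensor_lTensor_comm] at hz
  obtain ⟨y, hy⟩ := (lTensor_exact F h₀ hε _).1 hz
  obtain ⟨z, hz⟩ := (hM (π.rTensor Q₁ y)).1 (by
    rw [← rTensor_lTensor_comm, hy, rTensor_rTensor_eq_zero _ hex])
  obtain ⟨f, rfl⟩ := rTensor_surjective Q₂ hπ z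
  obtain ⟨w, hw⟩ := (rTensor_exact Q₁ hex hπ (y - d₂.lTensor F f)).1
    (by rw [map_sub, rTensor_lTensor_comm, hz, sub_self])
  have hwx : d₁.lTensor L w = x := by
    apply Module.Flat.rTensor_preserves_injective_linearMap (M := Q₀) ι hι
    rw [rTensor_lTensor_comm, hw, map_sub, hy, sub_eq_self, lTensor_lTensor_eq_zero _ h₁]
  rw [← hwx, lTensor_lTensor_eq_zero _ h₀]

/-- Let `0 → L → F` and `0 → L' → F' → L → 0` be exact with `F` flat, and let
`0 → N₁ → N₂ → N₃ → 0` be exact. If `L ⊗ N₁ → F ⊗ N₁` and `L' ⊗ N₂ → F' ⊗ N₂` are injective,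
then so is `L' ⊗ N₃ → F' ⊗ N₃`. -/
theorem rTensor_injective_of_shortExact {L' F' N₁ N₂ N₃ : Type*}
    [AddCommGroup L'] [Module R L'] [AddCommGroup F'] [Module R F']
    [AddCommGroup N₁] [Module R N₁] [AddCommGroup N₂] [Module R N₂]
    [AddCommGroup N₃] [Module R N₃] {ι' : L' →ₗ[R] F'} {π' : F' →ₗ[R] L}
    {f : N₁ →ₗ[R] N₂} {g : N₂ →ₗ[R] N₃} [Module.Flat R F]
    (hex' : Exact ι' π') (hπ' : Surjective π')
    (hf : Injective f) (hfg : Exact f g) (hg : Surjective g)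
    (h₁ : Injective (ι.rTensor N₁)) (h₂ : Injective (ι'.rTensor N₂)) :
    Injective (ι'.rTensor N₃) := by
  rw [injective_iff_map_eq_zero]
  intro z hz
  obtain ⟨y, rfl⟩ := lTensor_surjective L' hg z
  rw [rTensor_lTensor_comm] at hz
  obtain ⟨u, hu⟩ := (lTensor_exact F' hfg hg _).1 hz
  have hu0 : π'.rTensor N₁ u = 0 := by
    apply h₁
    apply Module.Flat.lTensor_preserves_injective_linearMap (M := F) f hf
    rw [map_zero, map_zero, ← rTensor_lTensor_comm, ← rTensor_lTensor_comm, hu,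
      rTensor_rTensor_eq_zero _ hex', map_zero]
  obtain ⟨v, rfl⟩ := (rTensor_exact N₁ hex' hπ' _).1 hu0
  have hvy : f.lTensor L' v = y := h₂ (by rw [rTensor_lTensor_comm, hu])
  rw [← hvy, lTensor_lTensor_eq_zero _ hfg]

end TensorExactness

section RegularLocal

open IsLocalRing

variable {A : Type*} [CommRing A] [IsLocalRing A]

/-- If the maximal ideal is generated by `n + 1` elements, then modulo any `a ∈ 𝔪 \ 𝔪²` it is
generated by `n` elements. -/
theorem exists_span_eq_maximalIdeal_quotient {n : ℕ} {x : Fin (n + 1) → A}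
    (hx : Ideal.span (Set.range x) = maximalIdeal A) {a : A} (ha : a ∈ maximalIdeal A)
    (ha2 : a ∉ maximalIdeal A ^ 2) [IsLocalRing (A ⧸ Ideal.span {a})] :
    ∃ y : Fin n → A ⧸ Ideal.span {a},
      Ideal.span (Set.range y) = maximalIdeal (A ⧸ Ideal.span {a}) := by
  obtain ⟨c, hc⟩ := (Ideal.mem_span_range_iff_exists_fun).1 (hx ▸ ha)
  have hxm (i) : x i ∈ maximalIdeal A := hx ▸ Ideal.subset_span ⟨i, rfl⟩
  obtain ⟨i, hi⟩ : ∃ i, IsUnit (c i) := by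
    by_contra! h
    refine ha2 (hc ▸ Ideal.sum_mem _ fun i _ ↦ ?_)
    rw [pow_two]
    exact Ideal.mul_mem_mul ((mem_maximalIdeal _).2 (h i)) (hxm i)
  let q := Ideal.Quotient.mk (Ideal.span {a})
  have hq : Function.Surjective q := Ideal.Quotient.mk_surjective
  refine ⟨fun j ↦ q (x (i.succAbove j)), le_antisymm ?_ ?_⟩
  · rw [Ideal.span_le]
    rintro _ ⟨j, rfl⟩
    have hle : (maximalIdeal A).map q ≤ maximalIdeal _ :=
      ((local_hom_TFAE q).out 0 2).1 (IsLocalHom.of_surjective q hq)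
    exact hle (Ideal.mem_map_of_mem q (hxm _))
  · have hmap : maximalIdeal (A ⧸ Ideal.span {a}) ≤ (maximalIdeal A).map q := by
      intro z hz
      obtain ⟨z, rfl⟩ := hq z
      refine Ideal.mem_map_of_mem q ((mem_maximalIdeal _).2 fun hu ↦ ?_)
      exact (mem_maximalIdeal _).1 hz (hu.map q)
    refine hmap.trans ?_
    rw [← hx, Ideal.map_span, Ideal.span_le]
    rintro _ ⟨_, ⟨j, rfl⟩, rfl⟩
    obtain rfl | ⟨k, rfl⟩ := Fin.eq_self_or_eq_succAbove i j
    · have h0 : q (c j) * q (x j) + ∑ k, q (c (j.succAbove k)) * q (x (j.succAbove k)) = 0 := by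
        have h : q (∑ i, c i * x i) = 0 :=
          Ideal.Quotient.eq_zero_iff_mem.2 (hc ▸ Ideal.mem_span_singleton_self a)
        rw [Fin.sum_univ_succAbove _ j] at h
        simpa using h
      have hs : q (c j) * q (x j) ∈
          Ideal.span (Set.range fun k ↦ q (x (j.succAbove k))) := by
        rw [eq_neg_of_add_eq_zero_left h0]
        exact neg_mem (Ideal.sum_mem _ fun k _ ↦
          Ideal.mul_mem_left _ _ (Ideal.subset_span ⟨k, rfl⟩))
      exact (Ideal.unit_mul_mem_iff_mem _ (hi.map q)).1 hs
    · exact Ideal.subset_span ⟨k, rfl⟩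

variable [IsNoetherianRing A]

/-- A regular local ring of positive dimension has a regular quotient by an element that avoids
all minimal primes. -/
theorem exists_regular_quotient {n : ℕ} {x : Fin (n + 1) → A}
    (hx : Ideal.span (Set.range x) = maximalIdeal A) (hd : ringKrullDim A = (n + 1 : ℕ)) :
    ∃ a : A, a ∈ maximalIdeal A ∧ (∀ p ∈ minimalPrimes A, a ∉ p) ∧
      ∃ (_ : IsLocalRing (A ⧸ Ideal.span {a})) (y : Fin n → A ⧸ Ideal.span {a}),
        Ideal.span (Set.range y) = maximalIdeal (A ⧸ Ideal.span {a}) ∧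
        ringKrullDim (A ⧸ Ideal.span {a}) = n := by
  have hmin : ∀ p ∈ minimalPrimes A, ¬ maximalIdeal A ≤ p := by
    intro p hp hle
    have := hp.1.1
    obtain rfl := le_antisymm hle (le_maximalIdeal_of_isPrime p)
    have h0 : (maximalIdeal A).height = 0 := Ideal.height_eq_zero_iff.2 hp
    rw [← maximalIdeal_height_eq_ringKrullDim, h0] at hd
    norm_cast at hd
  have hbot : maximalIdeal A ≠ ⊥ := fun h ↦ by
    obtain ⟨p, hp, -⟩ := Ideal.exists_minimalPrimes_le (bot_le : ⊥ ≤ maximalIdeal A)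
    exact hmin p hp (h ▸ bot_le)
  have hsq : ¬ maximalIdeal A ≤ maximalIdeal A ^ 2 := fun h ↦ hbot <|
    Submodule.eq_bot_of_le_smul_of_le_jacobson_bot (maximalIdeal A) _
      (IsNoetherian.noetherian _) (by rwa [smul_eq_mul, ← pow_two])
      (maximalIdeal_le_jacobson _)
  obtain ⟨a, ham, ha⟩ : ∃ a ∈ maximalIdeal A,
      a ∉ (maximalIdeal A ^ 2 : Ideal A) ∧ ∀ p ∈ minimalPrimes A, a ∉ p := by
    by_contra! h
    have hfin := Ideal.finite_minimalPrimes_of_isNoetherianRing (R := A) ⊥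
    have := (Ideal.subset_union_prime' (s := hfin.toFinset) (f := id) (a := maximalIdeal A ^ 2)
      (b := maximalIdeal A ^ 2) (I := maximalIdeal A)
      (fun p hp ↦ ((hfin.mem_toFinset).1 hp).1.1)).1 fun z hz ↦ by
        by_cases hz2 : z ∈ maximalIdeal A ^ 2
        · exact .inl (.inl hz2)
        · obtain ⟨p, hp, hzp⟩ := h z hz hz2
          exact .inr (Set.mem_biUnion (by simpa using hp) hzp)
    obtain h | h | ⟨p, hp, hle⟩ := this
    · exact hsq h
    · exact hsq h
    · exact hmin p ((hfin.mem_toFinset).1 hp) hle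
  have : Nontrivial (A ⧸ Ideal.span {a}) := Ideal.Quotient.nontrivial_iff.2 fun h ↦
    (maximalIdeal.isMaximal A).ne_top (top_le_iff.1 (h ▸ (Ideal.span_singleton_le_iff_mem _).2 ham))
  have hloc : IsLocalRing (A ⧸ Ideal.span {a}) :=
    .of_surjective' (Ideal.Quotient.mk (Ideal.span {a})) Ideal.Quotient.mk_surjective
  obtain ⟨y, hy⟩ := exists_span_eq_maximalIdeal_quotient hx ham ha.1
  refine ⟨a, ham, ha.2, hloc, y, hy, le_antisymm ?_ ?_⟩
  · refine (ringKrullDim_le_spanFinrank_maximalIdeal _).trans ?_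
    rw [← hy]
    have := Submodule.spanFinrank_span_le_ncard_of_finite (R := A ⧸ Ideal.span {a})
      (Set.finite_range y)
    have h2 : (Set.range y).ncard ≤ n := by
      rw [← Set.image_univ]
      exact (Set.ncard_image_le).trans (by simp)
    exact_mod_cast this.trans h2
  · have := Ideal.height_le_ringKrullDim_quotient_add_one ham
    rw [maximalIdeal_height_eq_ringKrullDim, hd] at this
    push_cast at this
    have hfin : ringKrullDim (A ⧸ Ideal.span {a}) ≠ ⊥ := ringKrullDim_ne_bot
    obtain ⟨m, hm⟩ := WithBot.ne_bot_iff_exists.1 hfin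
    rw [← hm] at this ⊢
    norm_cast at this ⊢
    exact (ENat.add_le_add_iff_right (by simp)).1 this

/-- Regular local rings are domains. -/
theorem isDomain_of_regular (n : ℕ) : ∀ {A : Type*} [CommRing A] [IsLocalRing A]
    [IsNoetherianRing A] {x : Fin n → A} (_ : Ideal.span (Set.range x) = maximalIdeal A)
    (_ : ringKrullDim A = n), IsDomain A := by
  induction n with
  | zero =>
    intro A _ _ _ x hx _
    have : (⊥ : Ideal A).IsPrime := by
      rw [show (⊥ : Ideal A) = maximalIdeal A by rw [← hx]; simp]
      infer_instance
    exact IsDomain.of_bot_isPrime A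
  | succ n ih =>
    intro A _ _ _ x hx hd
    obtain ⟨a, ham, ha, _, y, hy, hdy⟩ := exists_regular_quotient hx hd
    have hprime : (Ideal.span {a}).IsPrime :=
      (Ideal.Quotient.isDomain_iff_prime _).1 (ih hy hdy)
    obtain ⟨p, hp, hpa⟩ := Ideal.exists_minimalPrimes_le (bot_le : ⊥ ≤ Ideal.span {a})
    have := hp.1.1
    have hbot : p = ⊥ := by
      refine Submodule.eq_bot_of_le_smul_of_le_jacobson_bot (Ideal.span {a}) p
        (IsNoetherian.noetherian _) (fun z hz ↦ ?_)
        (((Ideal.span_singleton_le_iff_mem _).2 ham).trans (maximalIdeal_le_jacobson _))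
      obtain ⟨b, rfl⟩ := Ideal.mem_span_singleton'.1 (hpa hz)
      rw [smul_eq_mul, mul_comm b a]
      exact Ideal.mul_mem_mul (Ideal.mem_span_singleton_self a)
        ((this.mem_or_mem hz).resolve_right (ha p hp))
    exact @IsDomain.of_bot_isPrime A _ (hbot ▸ this)

end RegularLocal

/-- `Tor` can be computed from any projective resolution of the second argument. -/
theorem subsingleton_torMod_succ_iff {R : Type} [CommRing R] {M N : Type} [AddCommGroup M]
    [Module R M] [AddCommGroup N] [Module R N] (Q : ProjectiveResolution (ModuleCat.of R N))
    (i : ℕ) : Subsingleton (TorMod R (i + 1) M N) ↔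
      Function.Exact ((Q.complex.d (i + 2) (i + 1)).hom.lTensor M)
        ((Q.complex.d (i + 1) i).hom.lTensor M) := by
  let T := (MonoidalCategory.tensoringLeft (ModuleCat R)).obj (ModuleCat.of R M)
  have e : TorMod R (i + 1) M N ≅ ((T.mapHomologicalComplex _).obj Q.complex).homology (i + 1) :=
    Q.isoLeftDerivedObj T (i + 1)
  rw [← ModuleCat.isZero_iff_subsingleton, e.isZero_iff,
    ← HomologicalComplex.exactAt_iff_isZero_homology,
    HomologicalComplex.exactAt_iff' _ (i + 2) (i + 1) i (by simp) (by simp),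
    ShortComplex.ShortExact.moduleCat_exact_iff_function_exact]
  rfl

namespace CategoryTheory.ProjectiveResolution

variable {C : Type*} [Category* C] [Abelian C]

theorem exact_zero {Z : C} (P : ProjectiveResolution Z) :
    (ShortComplex.mk (P.complex.d 1 0) (P.π.f 0 : P.complex.X 0 ⟶ Z)
      P.complex_d_comp_π_f_zero).Exact :=
  ShortComplex.exact_of_g_is_cokernel _ P.isColimitCokernelCofork

variable (S : ShortComplex C) (P : ProjectiveResolution S.X₁)

/-- The map from a projective resolution of `S.X₁` to `S.X₂`. -/
abbrev spliceMap : P.complex.X 0 ⟶ S.X₂ :=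
  (P.π.f 0 : P.complex.X 0 ⟶ S.X₁) ≫ S.f

theorem d_comp_spliceMap : P.complex.d 1 0 ≫ spliceMap S P = 0 :=
  (P.complex_d_comp_π_f_zero =≫ S.f |> (Category.assoc _ _ _).symm.trans).trans Limits.zero_comp

theorem spliceMap_comp_g : spliceMap S P ≫ S.g = 0 :=
  (Category.assoc _ _ _).trans <|
    (congrArg (fun h ↦ (P.π.f 0 : P.complex.X 0 ⟶ S.X₁) ≫ h) S.zero).trans Limits.comp_zero

/-- Splicing a projective resolution of `S.X₁` with a short exact sequence `S` whose middle term
is projective. -/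
def splice (hS : S.ShortExact) [Projective S.X₂] : ProjectiveResolution S.X₃ where
  complex := P.complex.augment (spliceMap S P) (d_comp_spliceMap S P)
  projective n := by
    cases n with
    | zero => exact (inferInstance : Projective S.X₂)
    | succ n => exact P.projective n
  π := (ChainComplex.toSingle₀Equiv _ _).symm ⟨S.g, spliceMap_comp_g S P⟩
  quasiIso := ⟨fun n ↦ by
    have := hS.mono_f
    have := hS.epi_g
    cases n with
    | zero =>
      rw [ChainComplex.quasiIsoAt₀_iff, ShortComplex.quasiIso_iff_of_zeros']
      · let φ : ShortComplex.mk (spliceMap S P) S.g (spliceMap_comp_g S P) ⟶ S :=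
          { τ₁ := P.π.f 0, τ₂ := 𝟙 _, τ₃ := 𝟙 _ }
        have : Epi φ.τ₁ := inferInstanceAs (Epi (P.π.f 0))
        have : IsIso φ.τ₂ := inferInstanceAs (IsIso (𝟙 _))
        have : Mono φ.τ₃ := inferInstanceAs (Mono (𝟙 _))
        have hex := (ShortComplex.exact_iff_of_epi_of_isIso_of_mono φ).2 hS.exact
        refine (ShortComplex.exact_and_epi_g_iff_of_iso ?_).2 ⟨hex, hS.epi_g⟩
        exact ShortComplex.isoMk (Iso.refl _) (Iso.refl _) (Iso.refl _)
          ((Category.id_comp _).trans (Category.comp_id _).symm)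
          (by
            refine (Category.id_comp _).trans (Eq.trans ?_ (Category.comp_id _).symm)
            exact (ChainComplex.toSingle₀Equiv_symm_apply_f_zero S.g
              (C := P.complex.augment _ (d_comp_spliceMap S P)) (spliceMap_comp_g S P)).symm)
      all_goals rfl
    | succ n =>
      rw [quasiIsoAt_iff_exactAt']
      · rw [HomologicalComplex.exactAt_iff' _ (n + 2) (n + 1) n (by simp) (by simp)]
        cases n with
        | zero =>
          let φ : ShortComplex.mk (P.complex.d 1 0) (P.π.f 0 : P.complex.X 0 ⟶ S.X₁)
                P.complex_d_comp_π_f_zero ⟶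
              ShortComplex.mk (P.complex.d 1 0) (spliceMap S P) (d_comp_spliceMap S P) :=
            { τ₁ := 𝟙 _, τ₂ := 𝟙 _, τ₃ := S.f }
          have : Epi φ.τ₁ := inferInstanceAs (Epi (𝟙 _))
          have : IsIso φ.τ₂ := inferInstanceAs (IsIso (𝟙 _))
          have : Mono φ.τ₃ := hS.mono_f
          exact (ShortComplex.exact_iff_of_epi_of_isIso_of_mono φ).1 P.exact_zero
        | succ n => exact P.exact_succ n
      · apply ChainComplex.exactAt_succ_single_obj⟩

end CategoryTheory.ProjectiveResolution

namespace HasFiniteProjectiveDimension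

variable {R : Type} [Ring R]

theorem of_projective (M : Type) [AddCommGroup M] [Module R M] [Module.Projective R M] :
    HasFiniteProjectiveDimension R M := by
  have : Projective (ModuleCat.of R M) := (IsProjective.iff_projective M).1 ‹_›
  exact ⟨0, ProjectiveResolution.self _, fun i hi ↦
    HomologicalComplex.isZero_single_obj_X _ _ _ _ hi.ne'⟩

theorem of_exact {L F M : Type} [AddCommGroup L] [Module R L] [AddCommGroup F] [Module R F]
    [AddCommGroup M] [Module R M] [Module.Projective R F] {ι : L →ₗ[R] F} {π : F →ₗ[R] M}
    (hι : Function.Injective ι) (hex : Function.Exact ι π) (hπ : Function.Surjective π)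
    (hL : HasFiniteProjectiveDimension R L) : HasFiniteProjectiveDimension R M := by
  obtain ⟨n, P, hP⟩ := hL
  let S : ShortComplex (ModuleCat R) := ShortComplex.mk (ModuleCat.ofHom ι) (ModuleCat.ofHom π)
    (ModuleCat.hom_ext hex.linearMap_comp_eq_zero)
  have hS : S.ShortExact :=
    { exact := (ShortComplex.ShortExact.moduleCat_exact_iff_function_exact S).2 hex
      mono_f := (ModuleCat.mono_iff_injective _).2 hι
      epi_g := (ModuleCat.epi_iff_surjective _).2 hπ }
  have : Projective S.X₂ := (IsProjective.iff_projective F).1 ‹_›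
  refine ⟨n + 1, ProjectiveResolution.splice S P hS, fun i hi ↦ ?_⟩
  obtain _ | i := i
  · omega
  · exact hP i (by omega)

end HasFiniteProjectiveDimension

section Syzygies

universe u

open Function IsLocalRing TensorProduct

/-- A finite module over a Noetherian ring has a resolution by finite free modules, given by its
sequence of syzygies. -/
theorem exists_syzygies (R : Type u) [CommRing R] [IsNoetherianRing R] (M : Type u)
    [AddCommGroup M] [Module R M] [Module.Finite R M] :
    ∃ (S : ℕ → ModuleCat.{u} R) (r : ℕ → ℕ) (ι : ∀ j, S (j + 1) →ₗ[R] (Fin (r j) → R))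
      (π : ∀ j, (Fin (r j) → R) →ₗ[R] S j), S 0 = ModuleCat.of R M ∧
      ∀ j, Module.Finite R (S j) ∧ Injective (ι j) ∧ Exact (ι j) (π j) ∧ Surjective (π j) := by
  have step (X : {X : ModuleCat.{u} R // Module.Finite R X}) :
      ∃ (Y : {X : ModuleCat.{u} R // Module.Finite R X}) (r : ℕ) (ι : Y.1 →ₗ[R] (Fin r → R))
        (π : (Fin r → R) →ₗ[R] X.1), Injective ι ∧ Exact ι π ∧ Surjective π := by
    have := X.2
    obtain ⟨r, π, hπ⟩ := Module.Finite.exists_fin' R X.1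
    exact ⟨⟨ModuleCat.of R (LinearMap.ker π), inferInstanceAs (Module.Finite R (LinearMap.ker π))⟩,
      r, (LinearMap.ker π).subtype, π, Subtype.val_injective,
      LinearMap.exact_subtype_ker_map π, hπ⟩
  choose Y r ι π h using step
  let S (j : ℕ) : {X : ModuleCat.{u} R // Module.Finite R X} :=
    j.rec ⟨ModuleCat.of R M, ‹_›⟩ fun _ ↦ Y
  exact ⟨fun j ↦ (S j).1, fun j ↦ r (S j), fun j ↦ ι (S j), fun j ↦ π (S j), rfl,
    fun j ↦ ⟨(S j).2, h (S j)⟩⟩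

/-- If `M` has a flat resolution of length at most `n`, then `Torᵢ(M, N) = 0` for `i > n`. -/
theorem exact_lTensor_of_finite_flat_resolution {R : Type*} [CommRing R] {Q : ℕ → Type*}
    [∀ i, AddCommGroup (Q i)] [∀ i, Module R (Q i)] [∀ i, Module.Flat R (Q i)]
    {dQ : ∀ i, Q (i + 1) →ₗ[R] Q i} (hQ : ∀ i, Exact (dQ (i + 1)) (dQ i)) (n : ℕ) :
    ∀ {X : ℕ → Type u} [∀ i, AddCommGroup (X i)] [∀ i, Module R (X i)] [∀ i, Module.Flat R (X i)]
      {dX : ∀ i, X (i + 1) →ₗ[R] X i} (_ : ∀ i, Exact (dX (i + 1)) (dX i))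
      (_ : ∀ i ≥ n, Subsingleton (X i)) {M : Type u} [AddCommGroup M] [Module R M]
      {π : X 0 →ₗ[R] M} (_ : Exact (dX 0) π) (_ : Surjective π),
      ∀ i ≥ n, Exact ((dQ (i + 1)).lTensor M) ((dQ i).lTensor M) := by
  induction n with
  | zero =>
    intro X _ _ _ dX _ h0 M _ _ π _ hπ i _
    have := h0 0 le_rfl
    have : Subsingleton M := hπ.subsingleton
    intro y
    exact ⟨fun _ ↦ ⟨0, Subsingleton.elim _ _⟩, fun _ ↦ Subsingleton.elim _ _⟩
  | succ n ih =>
    intro X _ _ _ dX hX h0 M _ _ π hex hπ i hi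
    obtain ⟨i, rfl⟩ := Nat.exists_eq_add_of_le' (Nat.one_le_of_lt hi)
    let π' : X 1 →ₗ[R] LinearMap.ker π :=
      (dX 0).codRestrict _ fun x ↦ hex.apply_apply_eq_zero x
    refine exact_lTensor_of_exact_lTensor_syzygy (LinearMap.ker π).injective_subtype
      (LinearMap.exact_subtype_ker_map π) hπ (hQ (i + 1)) (hQ i)
      (ih (X := fun i ↦ X (i + 1)) (dX := fun i ↦ dX (i + 1)) (π := π')
        (fun i ↦ hX (i + 1)) (fun i hi ↦ h0 (i + 1) (by omega)) ?_ ?_ i (by omega))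
    · intro x
      rw [← hX 0 x]
      exact Subtype.ext_iff
    · rintro ⟨x, hx⟩
      obtain ⟨y, rfl⟩ := (hex x).1 hx
      exact ⟨y, rfl⟩

theorem rTensor_injective_of_linearEquiv {R L F N N' : Type*} [CommRing R] [AddCommGroup L]
    [Module R L] [AddCommGroup F] [Module R F] [AddCommGroup N] [Module R N] [AddCommGroup N']
    [Module R N'] {ι : L →ₗ[R] F} (e : N ≃ₗ[R] N') (h : Injective (ι.rTensor N)) :
    Injective (ι.rTensor N') := by
  intro y z hyz
  apply (e.symm.lTensor L).injective
  apply h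
  have := congrArg (e.symm.toLinearMap.lTensor F) hyz
  rwa [← rTensor_lTensor_comm, ← rTensor_lTensor_comm] at this

/-- A quotient of a local ring with trivial maximal ideal is the residue field. -/
theorem nonempty_linearEquiv_residueField {R A : Type*} [CommRing R] [IsLocalRing R] [CommRing A]
    [IsLocalRing A] [Algebra R A] (hs : Surjective (algebraMap R A))
    (hA : maximalIdeal A = ⊥) : Nonempty (A ≃ₗ[R] ResidueField R) := by
  have := IsLocalHom.of_surjective _ hs
  have hker : RingHom.ker (Algebra.ofId R A) = maximalIdeal R := by
    ext r
    rw [mem_maximalIdeal, mem_nonunits_iff, ← isUnit_map_iff (algebraMap R A), ← mem_nonunits_iff,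
      ← mem_maximalIdeal, hA]
    rfl
  exact ⟨(Ideal.quotientKerAlgEquivOfSurjective (f := Algebra.ofId R A) hs).symm.toLinearEquiv.trans
    (Submodule.quotEquivOfEq _ _ hker)⟩

/-- If `Tor` of the high syzygies against a regular quotient `A` of `R` vanishes, then so does
`Tor` of the high syzygies against the residue field. -/
theorem exists_rTensor_residueField_injective {R : Type*} [CommRing R] [IsLocalRing R]
    {S F : ℕ → Type*} [∀ j, AddCommGroup (S j)] [∀ j, Module R (S j)]
    [∀ j, AddCommGroup (F j)] [∀ j, Module R (F j)] [∀ j, Module.Flat R (F j)]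
    {ι : ∀ j, S (j + 1) →ₗ[R] F j} {π : ∀ j, F j →ₗ[R] S j}
    (hex : ∀ j, Exact (ι j) (π j)) (hπ : ∀ j, Surjective (π j)) (n : ℕ) :
    ∀ {A : Type u} [CommRing A] [IsLocalRing A] [IsNoetherianRing A] [Algebra R A] {x : Fin n → A}
      (_ : Surjective (algebraMap R A)) (_ : Ideal.span (Set.range x) = maximalIdeal A)
      (_ : ringKrullDim A = n) {n₀ : ℕ} (_ : ∀ j ≥ n₀, Injective ((ι j).rTensor A)),
      ∃ n₁, ∀ j ≥ n₁, Injective ((ι j).rTensor (ResidueField R)) := by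
  induction n with
  | zero =>
    intro A _ _ _ _ x hs hx _ n₀ h
    obtain ⟨e⟩ := nonempty_linearEquiv_residueField hs (by simp [← hx])
    exact ⟨n₀, fun j hj ↦ rTensor_injective_of_linearEquiv e (h j hj)⟩
  | succ n ih =>
    intro A _ _ _ _ x hs hx hd n₀ h
    have := isDomain_of_regular (n + 1) hx hd
    obtain ⟨a, ham, ha, _, y, hy, hdy⟩ := exists_regular_quotient hx hd
    have ha0 : a ≠ 0 := by
      rintro rfl
      obtain ⟨p, hp, -⟩ := Ideal.exists_minimalPrimes_le (bot_le : ⊥ ≤ maximalIdeal A)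
      exact ha p hp p.zero_mem
    refine ih (A := A ⧸ Ideal.span {a}) (Ideal.Quotient.mk_surjective.comp hs) hy hdy
      (n₀ := n₀ + 1) fun j hj ↦ ?_
    obtain ⟨j, rfl⟩ := Nat.exists_eq_add_of_le' (Nat.one_le_of_lt hj)
    refine rTensor_injective_of_shortExact (hex (j + 1)) (hπ (j + 1))
      (f := LinearMap.mulLeft R a) (g := (Ideal.Quotient.mkₐ R (Ideal.span {a})).toLinearMap)
      (mul_right_injective₀ ha0) (fun b ↦ ?_) Ideal.Quotient.mk_surjective (h j (by omega))
      (h (j + 1) (by omega))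
    refine Ideal.Quotient.eq_zero_iff_mem.trans (Ideal.mem_span_singleton'.trans ?_)
    simp [mul_comm]

end Syzygies

namespace CategoryTheory.ProjectiveResolution

open Function

variable {R : Type} [CommRing R] {N : Type} [AddCommGroup N] [Module R N]
  (Q : ProjectiveResolution (ModuleCat.of R N))

theorem flat_X (i : ℕ) : Module.Flat R (Q.complex.X i) :=
  have : Module.Projective R (Q.complex.X i) :=
    (IsProjective.iff_projective (Q.complex.X i)).2 (Q.projective i)
  inferInstance

theorem function_exact_d (i : ℕ) :
    Exact (Q.complex.d (i + 2) (i + 1)).hom (Q.complex.d (i + 1) i).hom :=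
  (ShortComplex.ShortExact.moduleCat_exact_iff_function_exact _).1 (Q.exact_succ i)

theorem function_exact_d_π :
    Exact (Q.complex.d 1 0).hom (Q.π.f 0 : Q.complex.X 0 ⟶ ModuleCat.of R N).hom :=
  (ShortComplex.ShortExact.moduleCat_exact_iff_function_exact _).1 Q.exact_zero

theorem π_surjective : Surjective (Q.π.f 0 : Q.complex.X 0 ⟶ ModuleCat.of R N).hom :=
  (ModuleCat.epi_iff_surjective _).1 (inferInstanceAs (Epi (Q.π.f 0)))

end CategoryTheory.ProjectiveResolution

section Main

variable {R : Type} [CommRing R] {M : Type} [AddCommGroup M] [Module R M]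

/-- `Tor` vanishes above the projective dimension. -/
theorem HasFiniteProjectiveDimension.exists_subsingleton_torMod
    (hM : HasFiniteProjectiveDimension R M) (N : Type) [AddCommGroup N] [Module R N] :
    ∃ n₀ : ℕ, ∀ i ≥ n₀, Subsingleton (TorMod R i M N) := by
  obtain ⟨n, P, hP⟩ := hM
  let Q := projectiveResolution (ModuleCat.of R N)
  have := P.flat_X
  have := Q.flat_X
  have hex := exact_lTensor_of_finite_flat_resolution (Q := fun i ↦ Q.complex.X i)
    Q.function_exact_d (n + 1) (X := fun i ↦ P.complex.X i) P.function_exact_d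
    (fun j hj ↦ ModuleCat.isZero_iff_subsingleton.1 (hP j hj)) P.function_exact_d_π P.π_surjective
  refine ⟨n + 2, fun i hi ↦ ?_⟩
  obtain ⟨i, rfl⟩ := Nat.exists_eq_add_of_le' (Nat.one_le_of_lt hi)
  exact (subsingleton_torMod_succ_iff Q i).2 (hex i (by omega))

variable [IsNoetherianRing R] [IsLocalRing R] [Module.Finite R M]

/-- If `Torᵢ(M, A) = 0` for large `i`, where `A` is a regular local quotient of `R`, then `M` has
finite projective dimension. -/
theorem HasFiniteProjectiveDimension.of_subsingleton_torMod {A : Type} [CommRing A] [IsLocalRing A]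
    [Algebra R A] (hs : Function.Surjective (algebraMap R A)) (hA : IsRegularLocal A) {n₀ : ℕ}
    (h : ∀ i ≥ n₀, Subsingleton (TorMod R i M A)) : HasFiniteProjectiveDimension R M := by
  obtain ⟨_, n, x, hx, hd⟩ := hA
  obtain ⟨S, r, ι, π, hS, hprop⟩ := exists_syzygies R M
  choose hfin hι hex hπ using hprop
  let Q := projectiveResolution (ModuleCat.of R A)
  have := Q.flat_X
  have hTor (j : ℕ) : ∀ i, n₀ ≤ i + j → Function.Exact
      ((Q.complex.d (i + 2) (i + 1)).hom.lTensor (S j))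
      ((Q.complex.d (i + 1) i).hom.lTensor (S j)) := by
    induction j with
    | zero =>
      intro i hi
      rw [hS]
      exact (subsingleton_torMod_succ_iff Q i).1 (h (i + 1) (by omega))
    | succ j ih =>
      exact fun i hi ↦ exact_lTensor_syzygy_of_exact_lTensor (hι j) (hex j) (hπ j)
        (Q.function_exact_d (i + 1)) (Q.function_exact_d i) (ih (i + 1) (by omega))
  obtain ⟨n₁, hn₁⟩ := exists_rTensor_residueField_injective hex hπ n hs hx hd
    (n₀ := n₀) fun j hj ↦ rTensor_injective_of_exact_lTensor (hι j) (hex j) (hπ j)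
      (Q.function_exact_d 0) Q.function_exact_d_π Q.π_surjective (hTor j 0 (by omega))
  have : Module.Free R (S n₁) := Module.free_of_lTensor_residueField_injective _ _ (hπ n₁)
    (hex n₁) ((LinearMap.lTensor_inj_iff_rTensor_inj _ _).2 (hn₁ n₁ le_rfl))
  have : Module.Projective R (S n₁) := Module.Projective.of_free
  have key (j : ℕ) (hj : HasFiniteProjectiveDimension R (S j)) :
      HasFiniteProjectiveDimension R (S 0) := by
    induction j with
    | zero => exact hj
    | succ j ih => exact ih (.of_exact (hι j) (hex j) (hπ j) hj)
  have := key n₁ (.of_projective _)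
  rwa [hS] at this

end Main

/-- Let `(R, m, K)` be a Noetherian local ring, `M` a finitely generated
`R`-module, and `P` an ideal of `R` such that `R/P` is a regular local ring. Then `M` has
finite projective dimension over `R` if and only if `Tor_i^R(M, R/P) = 0` for all
sufficiently large `i`. -/
theorem finite_projective_dimension_iff_tor_vanishes
    (R : Type) [CommRing R] [IsNoetherianRing R] [IsLocalRing R]
    (M : Type) [AddCommGroup M] [Module R M] [Module.Finite R M]
    (P : Ideal R) [IsLocalRing (R ⧸ P)] (hreg : IsRegularLocal (R ⧸ P)) :
    HasFiniteProjectiveDimension R M ↔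
      ∃ n₀ : ℕ, ∀ i ≥ n₀, Subsingleton (TorMod R i M (R ⧸ P)) := by
  exact ⟨fun h ↦ h.exists_subsingleton_torMod _, fun ⟨_, h⟩ ↦
    .of_subsingleton_torMod Ideal.Quotient.mk_surjective hreg h⟩
end
end

section
/- Let K be a field, let A = K[U,V,W,X,Y,Z]_m/(UX+VY+WZ) be the localization of K[U,V,W,X,Y,Z]/(UX+VY+WZ) at the maximal ideal m = (U,V,W,X,Y,Z), with u,v,w,x,y,z the images of the variables, and let P = (u,v,w)A. Define A-linear maps by the matrices φ₁ = (u v w) : A³ → A, φ₂ = [[x,0,−w,v],[y,w,0,−u],[z,−v,u,0]] : A⁴ → A³, φ₃ = [[0,u,v,w],[u,0,z,−y],[v,−z,0,x],[w,y,−x,0]] : A⁴ → A⁴, and φ₄ = [[0,x,y,z],[x,0,−w,v],[y,w,0,−u],[z,−v,u,0]] : A⁴ → A⁴. Then the 2-periodic complex ⋯ → A⁴ →(φ₃) A⁴ →(φ₄) A⁴ →(φ₃) A⁴ →(φ₂) A³ →(φ₁) A → 0 is a free resolution of A/P; that is, the image of φ₁ equals P, the kernel of φ₁ equals the image of φ₂,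 the kernel of φ₂ equals the image of φ₃, the kernel of φ₃ equals the image of φ₄, and the kernel of φ₄ equals the image of φ₃. -/
open MvPolynomial

noncomputable section

/-- The polynomial `UX + VY + WZ` (variables: `0 = U, 1 = V, 2 = W, 3 = X, 4 = Y, 5 = Z`). -/
def bPoly (K : Type) [Field K] : MvPolynomial (Fin 6) K :=
  X 0 * X 3 + X 1 * X 4 + X 2 * X 5

/-- The hypersurface `K[U,V,W,X,Y,Z]/(UX+VY+WZ)`. -/
def Bring (K : Type) [Field K] : Type :=
  MvPolynomial (Fin 6) K ⧸ Ideal.span {bPoly K}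

instance (K : Type) [Field K] : CommRing (Bring K) :=
  inferInstanceAs (CommRing (MvPolynomial (Fin 6) K ⧸ Ideal.span {bPoly K}))

/-- The quotient map onto the hypersurface. -/
def bMk (K : Type) [Field K] : MvPolynomial (Fin 6) K →+* Bring K :=
  Ideal.Quotient.mk (Ideal.span {bPoly K})

/-- The maximal ideal of `Bring K` generated by the images of the variables. -/
def mIdeal (K : Type) [Field K] : Ideal (Bring K) :=
  Ideal.span (Set.range fun i : Fin 6 => bMk K (X i))

/-- `A`, the localization of the hypersurface at the maximal ideal `m`. -/
def Aring (K : Type) [Field K] [(mIdeal K).IsPrime] : Type :=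
  Localization (mIdeal K).primeCompl

instance (K : Type) [Field K] [(mIdeal K).IsPrime] : CommRing (Aring K) :=
  inferInstanceAs (CommRing (Localization (mIdeal K).primeCompl))

instance (K : Type) [Field K] [(mIdeal K).IsPrime] : Algebra (Bring K) (Aring K) :=
  inferInstanceAs (Algebra (Bring K) (Localization (mIdeal K).primeCompl))

variable (K : Type) [Field K] [(mIdeal K).IsPrime]

/-- `u`, the image of `U` in `A`. -/
def uElt : Aring K := algebraMap (Bring K) (Aring K) (bMk K (X 0))
/-- `v`, the image of `V` in `A`. -/
def vElt : Aring K := algebraMap (Bring K) (Aring K) (bMk K (X 1))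
/-- `w`, the image of `W` in `A`. -/
def wElt : Aring K := algebraMap (Bring K) (Aring K) (bMk K (X 2))
/-- `x`, the image of `X` in `A`. -/
def xElt : Aring K := algebraMap (Bring K) (Aring K) (bMk K (X 3))
/-- `y`, the image of `Y` in `A`. -/
def yElt : Aring K := algebraMap (Bring K) (Aring K) (bMk K (X 4))
/-- `z`, the image of `Z` in `A`. -/
def zElt : Aring K := algebraMap (Bring K) (Aring K) (bMk K (X 5))

/-- The ideal `P = (u, v, w)` of `A`. -/
def Pideal : Ideal (Aring K) := Ideal.span {uElt K, vElt K, wElt K}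

/-- `φ₁ = (u v w) : A³ → A`. -/
def phi1 : (Fin 3 → Aring K) →ₗ[Aring K] Aring K :=
  (LinearMap.proj 0).comp (Matrix.mulVecLin !![uElt K, vElt K, wElt K])

/-- `φ₂ : A⁴ → A³`. -/
def phi2 : (Fin 4 → Aring K) →ₗ[Aring K] (Fin 3 → Aring K) :=
  Matrix.mulVecLin
    !![xElt K, 0, -wElt K, vElt K;
       yElt K, wElt K, 0, -uElt K;
       zElt K, -vElt K, uElt K, 0]

/-- `φ₃ : A⁴ → A⁴`. -/
def phi3 : (Fin 4 → Aring K) →ₗ[Aring K] (Fin 4 → Aring K) :=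
  Matrix.mulVecLin
    !![0, uElt K, vElt K, wElt K;
       uElt K, 0, zElt K, -yElt K;
       vElt K, -zElt K, 0, xElt K;
       wElt K, yElt K, -xElt K, 0]

/-- `φ₄ : A⁴ → A⁴`. -/
def phi4 : (Fin 4 → Aring K) →ₗ[Aring K] (Fin 4 → Aring K) :=
  Matrix.mulVecLin
    !![0, xElt K, yElt K, zElt K;
       xElt K, 0, -wElt K, vElt K;
       yElt K, wElt K, 0, -uElt K;
       zElt K, -vElt K, uElt K, 0]

section MatrixFamilies

open scoped Matrix

variable {R S : Type*} [CommRing R] [CommRing S]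

/-- The row `(u v w)` for `q = (u, v, w, x, y, z)`. -/
def rowMat (q : Fin 6 → R) : Matrix (Fin 1) (Fin 3) R :=
  !![q 0, q 1, q 2]

/-- The matrix of `φ₂` for `q = (u, v, w, x, y, z)`. -/
def syzygyMat (q : Fin 6 → R) : Matrix (Fin 3) (Fin 4) R :=
  !![q 3, 0, -q 2, q 1;
     q 4, q 2, 0, -q 0;
     q 5, -q 1, q 0, 0]

/-- The matrix of `φ₃` for `q = (u, v, w, x, y, z)`. -/
def factorMatLeft (q : Fin 6 → R) : Matrix (Fin 4) (Fin 4) R :=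
  !![0, q 0, q 1, q 2;
     q 0, 0, q 5, -q 4;
     q 1, -q 5, 0, q 3;
     q 2, q 4, -q 3, 0]

/-- The matrix of `φ₄` for `q = (u, v, w, x, y, z)`. -/
def factorMatRight (q : Fin 6 → R) : Matrix (Fin 4) (Fin 4) R :=
  !![0, q 3, q 4, q 5;
     q 3, 0, -q 2, q 1;
     q 4, q 2, 0, -q 0;
     q 5, -q 1, q 0, 0]

theorem rowMat_map (f : R →+* S) (q : Fin 6 → R) :
    (rowMat q).map f = rowMat (f ∘ q) := by
  ext i j; fin_cases i; fin_cases j <;> simp [rowMat]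

theorem syzygyMat_map (f : R →+* S) (q : Fin 6 → R) :
    (syzygyMat q).map f = syzygyMat (f ∘ q) := by
  ext i j; fin_cases i <;> fin_cases j <;> simp [syzygyMat]

theorem factorMatLeft_map (f : R →+* S) (q : Fin 6 → R) :
    (factorMatLeft q).map f = factorMatLeft (f ∘ q) := by
  ext i j; fin_cases i <;> fin_cases j <;> simp [factorMatLeft]

theorem factorMatRight_map (f : R →+* S) (q : Fin 6 → R) :
    (factorMatRight q).map f = factorMatRight (f ∘ q) := by
  ext i j; fin_cases i <;> fin_cases j <;> simp [factorMatRight]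

theorem factorMatLeft_mul_factorMatRight (q : Fin 6 → R) :
    factorMatLeft q * factorMatRight q =
      (q 0 * q 3 + q 1 * q 4 + q 2 * q 5) • (1 : Matrix (Fin 4) (Fin 4) R) := by
  ext i j
  fin_cases i <;> fin_cases j <;>
    simp [factorMatLeft, factorMatRight, Matrix.mul_apply, Fin.sum_univ_four] <;> ring

theorem factorMatRight_mul_factorMatLeft (q : Fin 6 → R) :
    factorMatRight q * factorMatLeft q =
      (q 0 * q 3 + q 1 * q 4 + q 2 * q 5) • (1 : Matrix (Fin 4) (Fin 4) R) := by
  ext i j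
  fin_cases i <;> fin_cases j <;>
    simp [factorMatLeft, factorMatRight, Matrix.mul_apply, Fin.sum_univ_four] <;> ring

theorem rowMat_mulVec (q : Fin 6 → R) (a : Fin 3 → R) :
    rowMat q *ᵥ a = ![q 0 * a 0 + q 1 * a 1 + q 2 * a 2] := by
  ext i
  fin_cases i
  simp [rowMat, Matrix.mulVec, dotProduct, Fin.sum_univ_three]

theorem syzygyMat_mulVec (q : Fin 6 → R) (a : Fin 4 → R) :
    syzygyMat q *ᵥ a = ![q 3 * a 0 - q 2 * a 2 + q 1 * a 3,
      q 4 * a 0 + q 2 * a 1 - q 0 * a 3, q 5 * a 0 - q 1 * a 1 + q 0 * a 2] := by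
  ext i
  fin_cases i <;> simp [syzygyMat, Matrix.mulVec, dotProduct, Fin.sum_univ_four] <;> ring

theorem factorMatRight_mulVec (q : Fin 6 → R) (a : Fin 4 → R) :
    factorMatRight q *ᵥ a =
      Matrix.vecCons (q 3 * a 1 + q 4 * a 2 + q 5 * a 3) (syzygyMat q *ᵥ a) := by
  ext i
  fin_cases i <;>
    simp [factorMatRight, syzygyMat, Matrix.mulVec, dotProduct, Fin.sum_univ_four]

theorem rowMat_mul_syzygyMat {q : Fin 6 → R}
    (hq : q 0 * q 3 + q 1 * q 4 + q 2 * q 5 = 0) : rowMat q * syzygyMat q = 0 := by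
  ext i j
  fin_cases i
  fin_cases j <;> simp [rowMat, syzygyMat, Matrix.mul_apply, Fin.sum_univ_three]
  · exact hq
  all_goals ring

/-- The inclusion `ker M ⊆ im N` for matrices `M` and `N` passes to localizations. -/
theorem exists_mulVec_eq_of_isLocalization {l m n : Type*} [Fintype m] [Fintype n] [Finite l]
    [Algebra R S] (T : Submonoid R) [IsLocalization T S]
    {M : Matrix l m R} {N : Matrix m n R}
    (h : ∀ a, M *ᵥ a = 0 → ∃ c, N *ᵥ c = a) {a : m → S}
    (ha : M.map (algebraMap R S) *ᵥ a = 0) :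
    ∃ c, N.map (algebraMap R S) *ᵥ c = a := by
  obtain ⟨s, hs⟩ := IsLocalization.exist_integer_multiples_of_finite T a
  choose b hb using hs
  have hb' : algebraMap R S ∘ b = algebraMap R S s • a := by
    ext i; simp [hb, Algebra.smul_def]
  have hMb : ∀ i, algebraMap R S ((M *ᵥ b) i) = 0 := fun i => by
    rw [RingHom.map_mulVec, hb', Matrix.mulVec_smul, ha]; simp
  have hex : ∀ i, ∃ t : T, (t : R) * (M *ᵥ b) i = 0 := fun i =>
    (IsLocalization.map_eq_zero_iff T S _).1 (hMb i)
  choose t ht using hex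
  cases nonempty_fintype l
  obtain ⟨c, hc⟩ := h (((∏ i, t i : T) : R) • b) (by
    ext i
    obtain ⟨r, hr⟩ := Finset.dvd_prod_of_mem t (Finset.mem_univ i)
    rw [Matrix.mulVec_smul, hr]
    simp only [Pi.smul_apply, smul_eq_mul, Submonoid.coe_mul, Pi.zero_apply]
    linear_combination (r : R) * ht i)
  have hu : IsUnit (algebraMap R S (((∏ i, t i : T) : R) * s)) :=
    IsLocalization.map_units S ((∏ i, t i) * s)
  obtain ⟨e, he⟩ := hu.exists_left_inv
  refine ⟨e • (algebraMap R S ∘ c), ?_⟩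
  ext i
  rw [Matrix.mulVec_smul, Pi.smul_apply, ← RingHom.map_mulVec, hc, Pi.smul_apply, smul_eq_mul,
    smul_eq_mul, map_mul, show algebraMap R S (b i) = algebraMap R S s * a i from congrFun hb' i]
  rw [map_mul] at he
  linear_combination a i * he

/-- A matrix factorization of a nonzerodivisor `f` is exact modulo `f`. -/
theorem exists_mulVec_eq_of_matrixFactorization {n : Type*} [Fintype n] [DecidableEq n]
    {f : R} (hf : f ∈ nonZeroDivisors R) {π : R →+* S} (hπ : Function.Surjective π)
    (hker : RingHom.ker π = Ideal.span {f}) {M N : Matrix n n R}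
    (hNM : N * M = f • (1 : Matrix n n R)) {a : n → S} (ha : M.map π *ᵥ a = 0) :
    ∃ c, N.map π *ᵥ c = a := by
  choose b hb using fun i => hπ (a i)
  have hex : ∀ i, ∃ d, (M *ᵥ b) i = f * d := fun i => by
    have h0 : (M *ᵥ b) i ∈ RingHom.ker π := by
      rw [RingHom.mem_ker, RingHom.map_mulVec, show π ∘ b = a from funext hb, ha, Pi.zero_apply]
    rw [hker] at h0
    exact Ideal.mem_span_singleton.1 h0
  choose d hd using hex
  have hMb : M *ᵥ b = f • d := funext hd
  have hfb : f • b = f • (N *ᵥ d) := by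
    rw [← Matrix.mulVec_smul, ← hMb, Matrix.mulVec_mulVec, hNM, Matrix.smul_mulVec,
      Matrix.one_mulVec]
  refine ⟨π ∘ d, funext fun i => ?_⟩
  rw [← RingHom.map_mulVec, ← hb i]
  exact congrArg π ((mul_cancel_left_mem_nonZeroDivisors hf).1 (congrFun hfb i)).symm

end MatrixFamilies

section Polynomial

open scoped Matrix

/-- The syzygies of three variables are the Koszul relations. -/
theorem exists_koszul_of_X_mul_add_eq_zero {σ k : Type*} [Field k] {i j l : σ}
    (hij : i ≠ j) (hil : i ≠ l) (hjl : j ≠ l) {a b c : MvPolynomial σ k}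
    (h : X i * a + X j * b + X l * c = 0) :
    ∃ p q r, a = X j * r - X l * p ∧ b = -(X i * r) - X l * q ∧ c = X i * p + X j * q := by
  have hmem : X l * c ∈ Ideal.span ((X : σ → MvPolynomial σ k) '' {i, j}) := by
    rw [Set.image_pair, Ideal.mem_span_pair]
    exact ⟨-a, -b, by linear_combination -h⟩
  have hc : c ∈ Ideal.span ((X : σ → MvPolynomial σ k) '' {i, j}) := by
    classical
    rw [mem_ideal_span_X_image] at hmem ⊢
    intro m hm
    obtain ⟨t, ht, htm⟩ := hmem (Finsupp.single l 1 + m) (by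
      rw [mem_support_iff, coeff_X_mul]; exact mem_support_iff.1 hm)
    refine ⟨t, ht, ?_⟩
    have hlt : l ≠ t := by
      rcases ht with rfl | rfl
      exacts [hil.symm, hjl.symm]
    simpa [Finsupp.single_apply, hlt] using htm
  rw [Set.image_pair, Ideal.mem_span_pair] at hc
  obtain ⟨p, q, rfl⟩ := hc
  have hdvd : (X j : MvPolynomial σ k) ∣ X i * (a + X l * p) :=
    ⟨-(b + X l * q), by linear_combination h⟩
  obtain ⟨r, hr⟩ := ((X_prime (R := k)).dvd_or_dvd hdvd).resolve_left
    (fun h' => hij (X_dvd_X.1 h').symm)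
  refine ⟨p, q, r, by linear_combination hr, ?_, by ring⟩
  refine mul_left_cancel₀ (X_ne_zero (R := k) j) ?_
  linear_combination h - X i * hr

variable (k : Type) [Field k]

theorem not_X_zero_dvd_bPoly : ¬ (X 0 : MvPolynomial (Fin 6) k) ∣ bPoly k := by
  rintro ⟨g, hg⟩
  have h := congrArg (eval ![0, 1, 0, 0, 1, 0]) hg
  simp [bPoly] at h

theorem bPoly_mem_nonZeroDivisors : bPoly k ∈ nonZeroDivisors (MvPolynomial (Fin 6) k) :=
  mem_nonZeroDivisors_of_ne_zero fun h => not_X_zero_dvd_bPoly k (h ▸ dvd_zero _)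

theorem bMk_surjective : Function.Surjective (bMk k) :=
  Ideal.Quotient.mk_surjective

theorem ker_bMk : RingHom.ker (bMk k) = Ideal.span {bPoly k} :=
  Ideal.mk_ker

theorem bMk_eq_zero_iff {p : MvPolynomial (Fin 6) k} : bMk k p = 0 ↔ bPoly k ∣ p := by
  rw [← RingHom.mem_ker, ker_bMk, Ideal.mem_span_singleton]

/-- The images `(u, v, w, x, y, z)` of the variables in the hypersurface. -/
def bVars : Fin 6 → Bring k := bMk k ∘ X

theorem bVars_relation :
    bVars k 0 * bVars k 3 + bVars k 1 * bVars k 4 + bVars k 2 * bVars k 5 = 0 := by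
  simp only [bVars, Function.comp_apply, ← map_mul, ← map_add]
  exact (bMk_eq_zero_iff k).2 dvd_rfl

theorem eq_zero_of_bVars_zero_mul_eq_zero {t : Bring k} (h : bVars k 0 * t = 0) : t = 0 := by
  obtain ⟨p, rfl⟩ := bMk_surjective k t
  rw [bVars, Function.comp_apply, ← map_mul, bMk_eq_zero_iff] at h
  obtain ⟨g, hg⟩ := h
  obtain ⟨e, rfl⟩ := ((X_prime (R := k)).dvd_or_dvd (hg ▸ dvd_mul_right (X 0) p)).resolve_left
    (not_X_zero_dvd_bPoly k)
  refine (bMk_eq_zero_iff k).2 ⟨e, mul_left_cancel₀ (X_ne_zero (R := k) 0) ?_⟩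
  linear_combination hg

theorem exists_syzygyMat_mulVec_eq {a : Fin 3 → Bring k} (ha : rowMat (bVars k) *ᵥ a = 0) :
    ∃ c, syzygyMat (bVars k) *ᵥ c = a := by
  choose b hb using fun i => bMk_surjective k (a i)
  obtain rfl : bMk k ∘ b = a := funext hb
  have h0 := congrFun ha 0
  simp only [rowMat_mulVec, bVars, Function.comp_apply, ← map_mul, ← map_add,
    Matrix.cons_val_zero, Pi.zero_apply, bMk_eq_zero_iff] at h0
  obtain ⟨d, hd⟩ := h0
  obtain ⟨p, q, r, h1, h2, h3⟩ := exists_koszul_of_X_mul_add_eq_zero (k := k)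
    (i := (0 : Fin 6)) (j := 1) (l := 2) (by decide) (by decide) (by decide)
    (a := b 0 - X 3 * d) (b := b 1 - X 4 * d) (c := b 2 - X 5 * d) (by
      rw [bPoly] at hd; linear_combination hd)
  refine ⟨bMk k ∘ ![d, -q, p, r], ?_⟩
  have hmap : syzygyMat (bVars k) = (syzygyMat X).map (bMk k) := (syzygyMat_map _ _).symm
  ext i
  rw [hmap, ← RingHom.map_mulVec, Function.comp_apply]
  congr 1
  rw [syzygyMat_mulVec]
  fin_cases i <;> simp
  · linear_combination -h1
  · linear_combination -h2
  · linear_combination -h3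

theorem exists_factorMatRight_mulVec_eq {a : Fin 4 → Bring k}
    (ha : factorMatLeft (bVars k) *ᵥ a = 0) : ∃ c, factorMatRight (bVars k) *ᵥ c = a := by
  rw [bVars, ← factorMatLeft_map] at ha
  rw [bVars, ← factorMatRight_map]
  exact exists_mulVec_eq_of_matrixFactorization (bPoly_mem_nonZeroDivisors k)
    (bMk_surjective k) (ker_bMk k) (factorMatRight_mul_factorMatLeft X) ha

theorem exists_factorMatLeft_mulVec_eq {a : Fin 4 → Bring k}
    (ha : factorMatRight (bVars k) *ᵥ a = 0) : ∃ c, factorMatLeft (bVars k) *ᵥ c = a := by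
  rw [bVars, ← factorMatRight_map] at ha
  rw [bVars, ← factorMatLeft_map]
  exact exists_mulVec_eq_of_matrixFactorization (bPoly_mem_nonZeroDivisors k)
    (bMk_surjective k) (ker_bMk k) (factorMatLeft_mul_factorMatRight X) ha

theorem factorMatRight_mulVec_eq_zero_of_syzygyMat {a : Fin 4 → Bring k}
    (ha : syzygyMat (bVars k) *ᵥ a = 0) : factorMatRight (bVars k) *ᵥ a = 0 := by
  have h : factorMatLeft (bVars k) *ᵥ (factorMatRight (bVars k) *ᵥ a) = 0 := by
    rw [Matrix.mulVec_mulVec, factorMatLeft_mul_factorMatRight, bVars_relation, zero_smul,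
      Matrix.zero_mulVec]
  rw [factorMatRight_mulVec, ha] at h ⊢
  have h1 := congrFun h 1
  simp [factorMatLeft, Matrix.mulVec, dotProduct, Fin.sum_univ_four] at h1
  rw [eq_zero_of_bVars_zero_mul_eq_zero k h1]
  ext i
  fin_cases i <;> rfl

end Polynomial

section Localized

open scoped Matrix

instance (k : Type) [Field k] [(mIdeal k).IsPrime] :
    IsLocalization (mIdeal k).primeCompl (Aring k) :=
  inferInstanceAs (IsLocalization _ (Localization (mIdeal k).primeCompl))

/-- The images `(u, v, w, x, y, z)` of the variables in `A`. -/
def aVars (k : Type) [Field k] [(mIdeal k).IsPrime] : Fin 6 → Aring k :=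
  algebraMap (Bring k) (Aring k) ∘ bVars k

variable (k : Type) [Field k] [(mIdeal k).IsPrime]

theorem aVars_relation :
    aVars k 0 * aVars k 3 + aVars k 1 * aVars k 4 + aVars k 2 * aVars k 5 = 0 := by
  simp only [aVars, Function.comp_apply, ← map_mul, ← map_add, bVars_relation, map_zero]

theorem phi1_apply (a : Fin 3 → Aring k) : phi1 k a = (rowMat (aVars k) *ᵥ a) 0 := rfl

theorem phi1_eq_zero_iff (a : Fin 3 → Aring k) : phi1 k a = 0 ↔ rowMat (aVars k) *ᵥ a = 0 := by
  rw [phi1_apply, funext_iff, Fin.forall_fin_one, Pi.zero_apply]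

theorem phi2_apply (a : Fin 4 → Aring k) : phi2 k a = syzygyMat (aVars k) *ᵥ a := rfl

theorem phi3_apply (a : Fin 4 → Aring k) : phi3 k a = factorMatLeft (aVars k) *ᵥ a := rfl

theorem phi4_apply (a : Fin 4 → Aring k) : phi4 k a = factorMatRight (aVars k) *ᵥ a := rfl

theorem phi3_phi4 (a : Fin 4 → Aring k) : phi3 k (phi4 k a) = 0 := by
  rw [phi4_apply, phi3_apply, Matrix.mulVec_mulVec, factorMatLeft_mul_factorMatRight,
    aVars_relation, zero_smul, Matrix.zero_mulVec]

theorem phi4_phi3 (a : Fin 4 → Aring k) : phi4 k (phi3 k a) = 0 := by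
  rw [phi3_apply, phi4_apply, Matrix.mulVec_mulVec, factorMatRight_mul_factorMatLeft,
    aVars_relation, zero_smul, Matrix.zero_mulVec]

theorem phi2_eq_zero_of_phi4_eq_zero {a : Fin 4 → Aring k} (ha : phi4 k a = 0) :
    phi2 k a = 0 := by
  rw [phi4_apply, factorMatRight_mulVec] at ha
  rw [phi2_apply]
  ext i
  exact congrFun ha i.succ

theorem phi1_phi2 (a : Fin 4 → Aring k) : phi1 k (phi2 k a) = 0 := by
  rw [phi1_eq_zero_iff, phi2_apply, Matrix.mulVec_mulVec,
    rowMat_mul_syzygyMat (aVars_relation k), Matrix.zero_mulVec]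

theorem range_phi1 : LinearMap.range (phi1 k) = Pideal k := by
  ext t
  rw [LinearMap.mem_range, Pideal, Ideal.mem_span_insert]
  simp only [Ideal.mem_span_pair, phi1_apply, rowMat_mulVec, Matrix.cons_val_zero]
  constructor
  · rintro ⟨a, rfl⟩
    exact ⟨a 0, _, ⟨a 1, a 2, rfl⟩, by
      simp only [uElt, vElt, wElt, aVars, bVars, Function.comp_apply]; ring⟩
  · rintro ⟨a, _, ⟨b, c, rfl⟩, rfl⟩
    refine ⟨![a, b, c], ?_⟩
    simp [uElt, vElt, wElt, aVars, bVars]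
    ring

end Localized

/-- The 2-periodic complex
`⋯ → A⁴ →(φ₃) A⁴ →(φ₄) A⁴ →(φ₃) A⁴ →(φ₂) A³ →(φ₁) A → 0`
is a free resolution of `A/P`. -/
theorem resolution_of_A_mod_P (K : Type) [Field K] [(mIdeal K).IsPrime] :
    LinearMap.range (phi1 K) = Pideal K ∧
    LinearMap.ker (phi1 K) = LinearMap.range (phi2 K) ∧
    LinearMap.ker (phi2 K) = LinearMap.range (phi3 K) ∧
    LinearMap.ker (phi3 K) = LinearMap.range (phi4 K) ∧
    LinearMap.ker (phi4 K) = LinearMap.range (phi3 K) := by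
  refine ⟨range_phi1 K, le_antisymm ?_ ?_, le_antisymm ?_ ?_, le_antisymm ?_ ?_,
    le_antisymm ?_ ?_⟩
  · intro a ha
    rw [LinearMap.mem_ker, phi1_eq_zero_iff, aVars, ← rowMat_map] at ha
    obtain ⟨c, hc⟩ := exists_mulVec_eq_of_isLocalization (mIdeal K).primeCompl
      (fun _ => exists_syzygyMat_mulVec_eq K) ha
    exact ⟨c, by rwa [phi2_apply, aVars, ← syzygyMat_map]⟩
  · rintro _ ⟨a, rfl⟩
    exact phi1_phi2 K a
  · intro a ha
    rw [LinearMap.mem_ker, phi2_apply, aVars, ← syzygyMat_map] at ha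
    obtain ⟨c, hc⟩ := exists_mulVec_eq_of_isLocalization (mIdeal K).primeCompl
      (fun _ h => exists_factorMatLeft_mulVec_eq K
        (factorMatRight_mulVec_eq_zero_of_syzygyMat K h)) ha
    exact ⟨c, by rwa [phi3_apply, aVars, ← factorMatLeft_map]⟩
  · rintro _ ⟨a, rfl⟩
    exact phi2_eq_zero_of_phi4_eq_zero K (phi4_phi3 K a)
  · intro a ha
    rw [LinearMap.mem_ker, phi3_apply, aVars, ← factorMatLeft_map] at ha
    obtain ⟨c, hc⟩ := exists_mulVec_eq_of_isLocalization (mIdeal K).primeCompl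
      (fun _ => exists_factorMatRight_mulVec_eq K) ha
    exact ⟨c, by rwa [phi4_apply, aVars, ← factorMatRight_map]⟩
  · rintro _ ⟨a, rfl⟩
    exact phi3_phi4 K a
  · intro a ha
    rw [LinearMap.mem_ker, phi4_apply, aVars, ← factorMatRight_map] at ha
    obtain ⟨c, hc⟩ := exists_mulVec_eq_of_isLocalization (mIdeal K).primeCompl
      (fun _ => exists_factorMatLeft_mulVec_eq K) ha
    exact ⟨c, by rwa [phi3_apply, aVars, ← factorMatLeft_map]⟩
  · rintro _ ⟨a, rfl⟩
    exact phi4_phi3 K a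
end
end

section
/- Let K be a field, let A = K[U,V,W,X,Y,Z]_m/(UX+VY+WZ) be the localization of K[U,V,W,X,Y,Z]/(UX+VY+WZ) at the maximal ideal m = (U,V,W,X,Y,Z), with u,v,w,x,y,z the images of the variables. Let P = (u,v,w)A and Q = (x,v,w)A. Then the sequence of A-modules 0 → A/Q → A/(v,w) → A/P → 0, in which the first map is multiplication by the element u and the second map is the natural surjection, is exact. -/
open MvPolynomial

set_option maxHeartbeats 1000000
set_option synthInstance.maxHeartbeats 1000000

noncomputable section

variable (K : Type) [Field K] [(mIdeal K).IsPrime]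

/-- The ideal `Q = (x, v, w)` of `A`. -/
def Qideal : Ideal (Aring K) := Ideal.span {xElt K, vElt K, wElt K}

/-- The ideal `(v, w)` of `A`. -/
def VWideal : Ideal (Aring K) := Ideal.span {vElt K, wElt K}

instance : IsLocalization (mIdeal K).primeCompl (Aring K) :=
  inferInstanceAs (IsLocalization (mIdeal K).primeCompl (Localization (mIdeal K).primeCompl))

lemma aeval_sub_self_mem {R σ : Type*} [CommRing R] {I : Ideal (MvPolynomial σ R)}
    {f : σ → MvPolynomial σ R} (hf : ∀ i, f i - X i ∈ I) (p : MvPolynomial σ R) :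
    aeval f p - p ∈ I := by
  have h : (Ideal.Quotient.mkₐ R I).comp (aeval f) = Ideal.Quotient.mkₐ R I := by
    ext i
    simpa using Ideal.Quotient.eq.mpr (hf i)
  exact Ideal.Quotient.eq.mp (DFunLike.congr_fun h p)

lemma exists_sub_mem_span_pair_of_mul_eq {K : Type*} [Field K]
    {p b c h : MvPolynomial (Fin 6) K}
    (hp : X 0 * p = X 1 * b + X 2 * c + X 0 * X 3 * h) :
    ∃ q, p - X 3 * q ∈ Ideal.span {(X 1 : MvPolynomial (Fin 6) K), X 2} := by
  let f : Fin 6 → MvPolynomial (Fin 6) K := ![X 0, 0, 0, X 3, X 4, X 5]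
  have hf (i) : f i - X i ∈ Ideal.span {(X 1 : MvPolynomial (Fin 6) K), X 2} := by
    have h1 : (X 1 : MvPolynomial (Fin 6) K) ∈ Ideal.span {(X 1 : MvPolynomial (Fin 6) K), X 2} :=
      Ideal.subset_span (by simp)
    have h2 : (X 2 : MvPolynomial (Fin 6) K) ∈ Ideal.span {(X 1 : MvPolynomial (Fin 6) K), X 2} :=
      Ideal.subset_span (by simp)
    fin_cases i <;> simp [f, h1, h2]
  have h0 := congrArg (aeval f) hp
  have hX : aeval f p = X 3 * aeval f h := by
    refine mul_left_cancel₀ (X_ne_zero (0 : Fin 6)) ?_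
    simpa [f, mul_assoc] using h0
  refine ⟨aeval f h, ?_⟩
  rw [← hX, ← neg_sub]
  exact neg_mem (aeval_sub_self_mem hf p)

lemma mem_span_of_mul_mem_span_pair {K : Type} [Field K] {a : Bring K}
    (ha : bMk K (X 0) * a ∈ Ideal.span {bMk K (X 1), bMk K (X 2)}) :
    a ∈ Ideal.span {bMk K (X 3), bMk K (X 1), bMk K (X 2)} := by
  have hsurj : Function.Surjective (bMk K) := Ideal.Quotient.mk_surjective
  obtain ⟨p, rfl⟩ := hsurj a
  obtain ⟨b, c, hbc⟩ := Ideal.mem_span_pair.mp ha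
  obtain ⟨b, rfl⟩ := hsurj b
  obtain ⟨c, rfl⟩ := hsurj c
  simp only [← map_mul, ← map_add] at hbc
  obtain ⟨h, hh⟩ := Ideal.mem_span_singleton'.mp (Ideal.Quotient.eq.mp hbc)
  unfold bPoly at hh
  obtain ⟨q, hq⟩ := exists_sub_mem_span_pair_of_mul_eq (p := p) (b := b - h * X 4)
    (c := c - h * X 5) (h := -h) (by linear_combination hh)
  obtain ⟨d, e, hde⟩ := Ideal.mem_span_pair.mp hq
  refine Ideal.mem_span_insert.mpr ⟨bMk K q, bMk K (p - X 3 * q), ?_, ?_⟩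
  · exact Ideal.mem_span_pair.mpr ⟨bMk K d, bMk K e, by simp only [← map_mul, ← map_add, hde]⟩
  · rw [← map_mul, ← map_add]
    congr 1
    ring

lemma VWideal_eq_map : VWideal K =
    (Ideal.span {bMk K (X 1), bMk K (X 2)}).map (algebraMap (Bring K) (Aring K)) := by
  simp [Ideal.map_span, Set.image_insert_eq, VWideal, vElt, wElt]

lemma Qideal_eq_map : Qideal K =
    (Ideal.span {bMk K (X 3), bMk K (X 1), bMk K (X 2)}).map
      (algebraMap (Bring K) (Aring K)) := by
  simp [Ideal.map_span, Set.image_insert_eq, Qideal, xElt, vElt, wElt]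

lemma mem_Qideal_of_uElt_mul_mem {α : Aring K} (h : uElt K * α ∈ VWideal K) :
    α ∈ Qideal K := by
  obtain ⟨a, s, rfl⟩ := IsLocalization.exists_mk'_eq (mIdeal K).primeCompl α
  rw [VWideal_eq_map, uElt, ← IsLocalization.mk'_one (M := (mIdeal K).primeCompl),
    ← IsLocalization.mk'_mul, IsLocalization.mk'_mem_map_algebraMap_iff] at h
  obtain ⟨t, ht, h⟩ := h
  rw [Qideal_eq_map, IsLocalization.mk'_mem_map_algebraMap_iff]
  exact ⟨t, ht, mem_span_of_mul_mem_span_pair (by rwa [mul_left_comm])⟩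

/-- The sequence of `A`-modules
`0 → A/Q → A/(v,w) → A/P → 0`, where the first map is multiplication by `u` and the second
is the natural surjection, is exact: the first map is injective, its range is the kernel of
the second map, and the second map is surjective. -/
theorem ses_A_mod_Q_A_mod_vw_A_mod_P (K : Type) [Field K] [(mIdeal K).IsPrime] :
    ∀ (f : (Aring K ⧸ Qideal K) →ₗ[Aring K] (Aring K ⧸ VWideal K))
      (g : (Aring K ⧸ VWideal K) →ₗ[Aring K] (Aring K ⧸ Pideal K)),
      (∀ α : Aring K, f (Ideal.Quotient.mk (Qideal K) α) =
        Ideal.Quotient.mk (VWideal K) (uElt K * α)) →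
      (∀ α : Aring K, g (Ideal.Quotient.mk (VWideal K) α) =
        Ideal.Quotient.mk (Pideal K) α) →
      Function.Injective f ∧ LinearMap.range f = LinearMap.ker g ∧ Function.Surjective g := by
  intro f g hf hg
  refine ⟨?_, ?_, ?_⟩
  · rw [injective_iff_map_eq_zero]
    intro a ha
    obtain ⟨α, rfl⟩ := Ideal.Quotient.mk_surjective a
    rw [hf, Ideal.Quotient.eq_zero_iff_mem] at ha
    exact Ideal.Quotient.eq_zero_iff_mem.mpr (mem_Qideal_of_uElt_mul_mem K ha)
  · ext b
    obtain ⟨β, rfl⟩ := Ideal.Quotient.mk_surjective b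
    rw [LinearMap.mem_ker, hg, Ideal.Quotient.eq_zero_iff_mem]
    constructor
    · rintro ⟨a, ha⟩
      obtain ⟨α, rfl⟩ := Ideal.Quotient.mk_surjective a
      rw [hf] at ha
      have hle : VWideal K ≤ Pideal K := Ideal.span_mono (Set.subset_insert _ _)
      have hu : uElt K * α ∈ Pideal K :=
        Ideal.mul_mem_right _ _ (Ideal.subset_span (Set.mem_insert _ _))
      exact (Submodule.sub_mem_iff_right _ hu).mp (hle (Ideal.Quotient.eq.mp ha))
    · intro hβ
      obtain ⟨α, c, hc, rfl⟩ := Ideal.mem_span_insert.mp hβ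
      refine ⟨Ideal.Quotient.mk _ α, ?_⟩
      have hc : c ∈ VWideal K := hc
      rw [hf, map_add, Ideal.Quotient.eq_zero_iff_mem.mpr hc, add_zero, mul_comm]
  · intro c
    obtain ⟨γ, rfl⟩ := Ideal.Quotient.mk_surjective c
    exact ⟨_, hg γ⟩
end
end

section
/- Let K be a field of characteristic 2, let A = K[U,V,W,X,Y,Z]_m/(UX+VY+WZ) be the localization of K[U,V,W,X,Y,Z]/(UX+VY+WZ) at the maximal ideal m = (U,V,W,X,Y,Z), with u,v,w,x,y,z the images of the variables, let L = Frac(A), let Ω be an algebraic closure of L, let a, b, c, d, e ∈ Ω be the square roots of uyz, vxz, wxy, uvw, vwyz respectively, and let R = A[a,b,c,d,e] ⊆ Ω. Then the five elements u, x, v, y, w−z of R are algebraically independent over K, and the fraction field of R is an extension of degree 8 of the subfield K(u, x, v, y, w−z). -/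
open MvPolynomial

set_option maxHeartbeats 1000000
set_option synthInstance.maxHeartbeats 1000000

noncomputable section

variable (K : Type) [Field K] [(mIdeal K).IsPrime]

/-- `L = Frac(A)`, the fraction field of `A`. -/
def Lfield (K : Type) [Field K] [(mIdeal K).IsPrime] : Type :=
  FractionRing (Aring K)

instance (K : Type) [Field K] [(mIdeal K).IsPrime] [IsDomain (Aring K)] :
    Field (Lfield K) := inferInstanceAs (Field (FractionRing (Aring K)))

instance (K : Type) [Field K] [(mIdeal K).IsPrime] [IsDomain (Aring K)] :
    Algebra (Aring K) (Lfield K) := inferInstanceAs (Algebra (Aring K) (FractionRing (Aring K)))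

variable (K : Type) [Field K] [(mIdeal K).IsPrime] [IsDomain (Aring K)]

/-- `Ω`, an algebraic closure of `L`. -/
def Omega : Type := AlgebraicClosure (Lfield K)

instance : Field (Omega K) := inferInstanceAs (Field (AlgebraicClosure (Lfield K)))

instance : Algebra (Lfield K) (Omega K) :=
  inferInstanceAs (Algebra (Lfield K) (AlgebraicClosure (Lfield K)))

instance : IsAlgClosed (Omega K) := inferInstanceAs (IsAlgClosed (AlgebraicClosure (Lfield K)))

instance : Algebra.IsAlgebraic (Lfield K) (Omega K) :=
  inferInstanceAs (Algebra.IsAlgebraic (Lfield K) (AlgebraicClosure (Lfield K)))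

instance : Algebra (Aring K) (Omega K) :=
  ((algebraMap (Lfield K) (Omega K)).comp (algebraMap (Aring K) (Lfield K))).toAlgebra

/-- The image of an element of `A` in `Ω`. -/
def toOmega (α : Aring K) : Omega K := algebraMap (Aring K) (Omega K) α

instance (K : Type) [Field K] [(mIdeal K).IsPrime] : Algebra K (Aring K) :=
  ((algebraMap (Bring K) (Aring K)).comp
    ((bMk K).comp (algebraMap K (MvPolynomial (Fin 6) K)))).toAlgebra

instance (K : Type) [Field K] [(mIdeal K).IsPrime] [IsDomain (Aring K)] :
    Algebra K (Omega K) :=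
  ((algebraMap (Aring K) (Omega K)).comp (algebraMap K (Aring K))).toAlgebra

section QuadraticStep

open Polynomial IntermediateField

variable {k E : Type*} [Field k] [Field E] [Algebra k E]

/-- Adjoining a root of a monic quadratic polynomial that is not already in the field. -/
theorem relfinrank_sup_adjoin_quadratic (F : IntermediateField k E) {α p q : E} (hα : α ∉ F)
    (hp : p ∈ F) (hq : q ∈ F) (h : α ^ 2 = p * α + q) :
    relfinrank F (F ⊔ adjoin k {α}) = 2 := by
  rw [relfinrank_eq_finrank_of_le le_sup_left]
  have h1 : extendScalars (le_sup_left : F ≤ F ⊔ adjoin k {α}) = adjoin F {α} := by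
    apply restrictScalars_injective k
    rw [extendScalars_restrictScalars, restrictScalars_adjoin_eq_sup]
  let p' : F := ⟨p, hp⟩
  let q' : F := ⟨q, hq⟩
  let f : Polynomial F := Polynomial.X ^ 2 - (Polynomial.C p' * Polynomial.X + Polynomial.C q')
  have hf : f.Monic :=
    monic_X_pow_sub (lt_of_le_of_lt degree_linear_le (by norm_num))
  have hf0 : Polynomial.aeval α f = 0 := by
    simp only [f, map_sub, map_pow, map_add, map_mul, Polynomial.aeval_X, Polynomial.aeval_C]
    exact sub_eq_zero.mpr h
  have hint : IsIntegral F α := ⟨f, hf, hf0⟩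
  rw [h1, adjoin.finrank hint]
  apply le_antisymm
  · refine (natDegree_le_natDegree (minpoly.min F α hf hf0)).trans ?_
    simp only [f]
    compute_degree
  · rw [minpoly.two_le_natDegree_iff hint]
    rintro ⟨y, rfl⟩
    exact hα y.2

/-- Elements of a quadratic extension are linear combinations of `1` and the generator. -/
theorem mem_sup_adjoin_quadratic (F : IntermediateField k E) {α p q : E}
    (hp : p ∈ F) (hq : q ∈ F) (h : α ^ 2 = p * α + q) {t : E}
    (ht : t ∈ F ⊔ adjoin k {α}) : ∃ r ∈ F, ∃ s ∈ F, t = r + s * α := by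
  have hint : IsIntegral F α := by
    let p' : F := ⟨p, hp⟩
    let q' : F := ⟨q, hq⟩
    refine ⟨Polynomial.X ^ 2 - (Polynomial.C p' * Polynomial.X + Polynomial.C q'), ?_, ?_⟩
    · exact monic_X_pow_sub (lt_of_le_of_lt degree_linear_le (by norm_num))
    · simp only [Polynomial.eval₂_sub, Polynomial.eval₂_add, Polynomial.eval₂_mul,
        Polynomial.eval₂_X_pow, Polynomial.eval₂_X, Polynomial.eval₂_C]
      exact sub_eq_zero.mpr h
  rw [← restrictScalars_adjoin_eq_sup, mem_restrictScalars, ← mem_toSubalgebra,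
    adjoin_simple_toSubalgebra_of_isAlgebraic hint.isAlgebraic] at ht
  induction ht using Algebra.adjoin_induction with
  | mem x hx => exact ⟨0, F.zero_mem, 1, F.one_mem, by simpa using hx⟩
  | algebraMap r => exact ⟨r, r.2, 0, F.zero_mem, by simp⟩
  | add x y _ _ hx hy =>
    obtain ⟨r, hr, s, hs, rfl⟩ := hx
    obtain ⟨r', hr', s', hs', rfl⟩ := hy
    exact ⟨r + r', F.add_mem hr hr', s + s', F.add_mem hs hs', by ring⟩
  | mul x y _ _ hx hy =>
    obtain ⟨r, hr, s, hs, rfl⟩ := hx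
    obtain ⟨r', hr', s', hs', rfl⟩ := hy
    refine ⟨r * r' + s * s' * q, F.add_mem (F.mul_mem hr hr') (F.mul_mem (F.mul_mem hs hs') hq),
      r * s' + s * r' + s * s' * p, F.add_mem (F.add_mem (F.mul_mem hr hs') (F.mul_mem hs hr'))
        (F.mul_mem (F.mul_mem hs hs') hp), ?_⟩
    linear_combination s * s' * h

end QuadraticStep

section PolynomialSquares

variable {k : Type*} [Field k] [CharP k 2]

/-- In characteristic two, partial derivatives are linear over squares. -/
theorem pderiv_sq_mul {σ : Type*} (i : σ) (p q : MvPolynomial σ k) :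
    pderiv i (p ^ 2 * q) = p ^ 2 * pderiv i q := by
  have h2 : (2 : MvPolynomial σ k) = 0 := CharTwo.two_eq_zero
  rw [Derivation.leibniz, sq, Derivation.leibniz]
  simp only [smul_eq_mul]
  linear_combination q * p * pderiv i p * h2

/-- Variables are `u, x, v, y, z`: `uvxy` is not a square of a rational function. -/
theorem eq_zero_of_sq_eq_sq_mul (p q : MvPolynomial (Fin 5) k)
    (h : p ^ 2 * 1 = q ^ 2 * (X 0 * X 2 * X 1 * X 3)) : q = 0 := by
  have h1 := congrArg (pderiv 0) h
  rw [pderiv_sq_mul, pderiv_sq_mul] at h1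
  simp [Derivation.leibniz, pderiv_X] at h1
  simpa using h1

/-- Variables are `u, x, v, y, z`: `uyz` is not a sum `p² + q²uvxy` of rational functions. -/
theorem eq_zero_of_sq_add_sq_mul_eq (p q r : MvPolynomial (Fin 5) k)
    (h : p ^ 2 * 1 + q ^ 2 * (X 0 * X 2 * X 1 * X 3) = r ^ 2 * (X 0 * X 3 * X 4)) : r = 0 := by
  have h1 := congrArg (pderiv 4) h
  rw [map_add, pderiv_sq_mul, pderiv_sq_mul, pderiv_sq_mul] at h1
  simp [Derivation.leibniz, pderiv_X] at h1
  simpa using h1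

end PolynomialSquares

section Hypersurface

variable (K : Type) [Field K]

theorem bMk_sub_constantCoeff_mem (p : MvPolynomial (Fin 6) K) :
    bMk K (p - C (constantCoeff p)) ∈ mIdeal K := by
  induction p using MvPolynomial.induction_on with
  | C a => simp
  | add p q hp hq =>
    have := (mIdeal K).add_mem hp hq
    rw [← map_add] at this
    convert this using 2
    simp only [map_add]
    ring
  | mul_X p i _ =>
    simp only [map_mul, constantCoeff_X, mul_zero, map_zero, sub_zero]
    exact (mIdeal K).mul_mem_left _ (Ideal.subset_span ⟨i, rfl⟩)

/-- A substitution without constant terms that satisfies the equation of the hypersurface. -/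
def scaledPoint : Fin 6 → MvPolynomial (Fin 6) K :=
  ![X 0 * X 5, X 1 * X 5, -(X 5 * (X 0 * X 3 + X 1 * X 4)), X 3 * X 5, X 4 * X 5, X 5]

theorem constantCoeff_aeval_scaledPoint (p : MvPolynomial (Fin 6) K) :
    constantCoeff (aeval (scaledPoint K) p) = constantCoeff p := by
  have : (constantCoeff.comp (aeval (scaledPoint K)).toRingHom : MvPolynomial (Fin 6) K →+* K)
      = constantCoeff := by
    apply MvPolynomial.ringHom_ext
    · intro r
      simp
    · intro i
      fin_cases i <;> simp [scaledPoint]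
  exact congrArg (fun f : MvPolynomial (Fin 6) K →+* K => f p) this

end Hypersurface

section LocalRing

variable (K : Type) [Field K] [(mIdeal K).IsPrime]

instance inst_s8 : IsLocalization (mIdeal K).primeCompl (Aring K) :=
  inferInstanceAs (IsLocalization (mIdeal K).primeCompl (Localization (mIdeal K).primeCompl))

instance [IsDomain (Aring K)] : IsFractionRing (Aring K) (Lfield K) :=
  inferInstanceAs (IsFractionRing (Aring K) (FractionRing (Aring K)))

/-- A polynomial vanishing in the local ring vanishes at all points of the hypersurface with
nonzero last coordinate, over any extension field. -/
theorem aeval_eq_zero_of_algebraMap_bMk_eq_zero {E : Type*} [Field E] [Algebra K E]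
    (u v w x y z : E) (hz : z ≠ 0) (hrel : u * x + v * y + w * z = 0)
    (p : MvPolynomial (Fin 6) K) (hp : algebraMap (Bring K) (Aring K) (bMk K p) = 0) :
    aeval ![u, v, w, x, y, z] p = 0 := by
  rw [IsLocalization.map_eq_zero_iff (mIdeal K).primeCompl] at hp
  obtain ⟨⟨m, hm⟩, hmp⟩ := hp
  obtain ⟨s, rfl⟩ : ∃ s, bMk K s = m := Ideal.Quotient.mk_surjective m
  have hs : constantCoeff s ≠ 0 := by
    intro h0
    apply hm
    simpa [h0] using bMk_sub_constantCoeff_mem K s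
  have hdvd : bPoly K ∣ s * p := by
    rw [← Ideal.mem_span_singleton, ← Ideal.Quotient.eq_zero_iff_mem]
    have : bMk K (s * p) = 0 := by rw [map_mul]; exact hmp
    exact this
  obtain ⟨r, hr⟩ := hdvd
  have h1 : aeval (scaledPoint K) s * aeval (scaledPoint K) p = 0 := by
    rw [← map_mul, hr, map_mul]
    have : aeval (scaledPoint K) (bPoly K) = 0 := by
      simp [bPoly, scaledPoint]
      ring
    rw [this, zero_mul]
  have h2 : aeval (scaledPoint K) s ≠ 0 := by
    intro h0
    apply hs
    rw [← constantCoeff_aeval_scaledPoint, h0, map_zero]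
  have h3 := (mul_eq_zero.mp h1).resolve_left h2
  have h4 : (aeval (R := K) ![u / z, v / z, 0, x / z, y / z, z]).comp (aeval (scaledPoint K))
      = aeval ![u, v, w, x, y, z] := by
    apply MvPolynomial.algHom_ext
    intro i
    fin_cases i <;> simp [scaledPoint, hz]
    field_simp
    linear_combination -hrel
  rw [← h4, AlgHom.comp_apply, h3, map_zero]

variable [IsDomain (Aring K)]

instance : IsScalarTower K (Aring K) (Omega K) := IsScalarTower.of_algebraMap_eq fun _ => rfl

theorem toOmega_injective : Function.Injective (toOmega K) :=
  (algebraMap (Lfield K) (Omega K)).injective.comp (IsFractionRing.injective (Aring K) (Lfield K))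

theorem aeval_generators (p : MvPolynomial (Fin 6) K) :
    aeval ![toOmega K (uElt K), toOmega K (vElt K), toOmega K (wElt K), toOmega K (xElt K),
      toOmega K (yElt K), toOmega K (zElt K)] p =
      toOmega K (algebraMap (Bring K) (Aring K) (bMk K p)) := by
  have : (aeval (R := K) ![toOmega K (uElt K), toOmega K (vElt K), toOmega K (wElt K),
      toOmega K (xElt K), toOmega K (yElt K), toOmega K (zElt K)]).toRingHom =
      (algebraMap (Aring K) (Omega K)).comp ((algebraMap (Bring K) (Aring K)).comp (bMk K)) := by
    apply MvPolynomial.ringHom_ext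
    · intro r
      simp
      rfl
    · intro i
      fin_cases i <;> simp <;> rfl
  exact congrArg (fun f : MvPolynomial (Fin 6) K →+* Omega K => f p) this

/-- Polynomial relations among the generators in `Ω` hold at every point of the hypersurface with
nonzero last coordinate. -/
theorem aeval_eq_zero_of_aeval_generators {E : Type*} [Field E] [Algebra K E]
    (u v w x y z : E) (hz : z ≠ 0) (hrel : u * x + v * y + w * z = 0)
    (p : MvPolynomial (Fin 6) K)
    (hp : aeval ![toOmega K (uElt K), toOmega K (vElt K), toOmega K (wElt K), toOmega K (xElt K),
      toOmega K (yElt K), toOmega K (zElt K)] p = 0) :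
    aeval ![u, v, w, x, y, z] p = 0 := by
  apply aeval_eq_zero_of_algebraMap_bMk_eq_zero K u v w x y z hz hrel
  apply toOmega_injective K
  rw [← aeval_generators, hp]
  exact (map_zero (algebraMap (Aring K) (Omega K))).symm

theorem toOmega_relation : toOmega K (uElt K) * toOmega K (xElt K) +
    toOmega K (vElt K) * toOmega K (yElt K) + toOmega K (wElt K) * toOmega K (zElt K) = 0 := by
  have h := aeval_generators K (bPoly K)
  have h0 : bMk K (bPoly K) = 0 :=
    Ideal.Quotient.eq_zero_iff_mem.mpr (Ideal.mem_span_singleton_self _)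
  rw [h0, map_zero] at h
  have h1 : toOmega K 0 = 0 := map_zero (algebraMap (Aring K) (Omega K))
  simpa [bPoly, h1] using h

theorem toOmega_sub (α β : Aring K) : toOmega K (α - β) = toOmega K α - toOmega K β :=
  map_sub (algebraMap (Aring K) (Omega K)) α β

theorem toOmega_mul (α β : Aring K) : toOmega K (α * β) = toOmega K α * toOmega K β :=
  map_mul (algebraMap (Aring K) (Omega K)) α β

theorem toOmega_zElt_ne_zero : toOmega K (zElt K) ≠ 0 := by
  intro h
  have := aeval_eq_zero_of_aeval_generators K (E := K) 0 0 0 0 0 1 one_ne_zero (by ring) (X 5)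
    (by simpa using h)
  simp at this

theorem toOmega_wElt_ne_zElt : toOmega K (wElt K) ≠ toOmega K (zElt K) := by
  intro h
  have := aeval_eq_zero_of_aeval_generators K (E := K) 0 0 0 0 0 1 one_ne_zero (by ring) (X 2 - X 5)
    (by simp [h])
  simp at this

theorem toOmega_wElt_ne_zero : toOmega K (wElt K) ≠ 0 := by
  intro h
  have := aeval_eq_zero_of_aeval_generators K (E := K) 1 0 1 (-1) 0 1 one_ne_zero (by ring) (X 2)
    (by simpa using h)
  simp at this

theorem algebraicIndependent_coordinates : AlgebraicIndependent K
    ![toOmega K (uElt K), toOmega K (xElt K), toOmega K (vElt K), toOmega K (yElt K),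
      toOmega K (zElt K)] := by
  rw [algebraicIndependent_iff]
  intro p hp
  let T := FractionRing (MvPolynomial (Fin 5) K)
  let g : Fin 5 → T := fun i => algebraMap (MvPolynomial (Fin 5) K) T (X i)
  have hinj : Function.Injective (algebraMap (MvPolynomial (Fin 5) K) T) :=
    IsFractionRing.injective _ _
  have hg4 : g 4 ≠ 0 := by
    rw [Ne, ← map_zero (algebraMap (MvPolynomial (Fin 5) K) T), hinj.eq_iff]
    exact X_ne_zero 4
  let φ : MvPolynomial (Fin 5) K →ₐ[K] MvPolynomial (Fin 6) K := aeval ![X 0, X 3, X 1, X 4, X 5]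
  have h1 := aeval_eq_zero_of_aeval_generators K (g 0) (g 2) (-(g 0 * g 1 + g 2 * g 3) / g 4)
    (g 1) (g 3) (g 4) hg4 (by rw [div_mul_cancel₀ _ hg4]; ring) (φ p) (by
      rw [← hp, ← AlgHom.comp_apply]
      congr 1
      apply MvPolynomial.algHom_ext
      intro i
      fin_cases i <;> simp [φ])
  have h2 : (aeval (R := K) ![g 0, g 2, -(g 0 * g 1 + g 2 * g 3) / g 4, g 1, g 3, g 4]).comp φ
      = IsScalarTower.toAlgHom K (MvPolynomial (Fin 5) K) T := by
    apply MvPolynomial.algHom_ext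
    intro i
    fin_cases i <;> simp [φ, g]
  apply hinj
  rw [map_zero, ← h1, ← AlgHom.comp_apply, h2]
  rfl

theorem algebraicIndependent_parameters : AlgebraicIndependent K
    ![toOmega K (uElt K), toOmega K (xElt K), toOmega K (vElt K), toOmega K (yElt K),
      toOmega K (wElt K - zElt K)] := by
  rw [algebraicIndependent_iff]
  intro p hp
  let T := AlgebraicClosure (FractionRing (MvPolynomial (Fin 5) K))
  have hinj : Function.Injective (algebraMap (MvPolynomial (Fin 5) K) T) := by
    rw [IsScalarTower.algebraMap_eq _ (FractionRing (MvPolynomial (Fin 5) K)) T]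
    exact (algebraMap (FractionRing (MvPolynomial (Fin 5) K)) T).injective.comp
      (IsFractionRing.injective _ _)
  let g : Fin 5 → T := fun i => algebraMap (MvPolynomial (Fin 5) K) T (X i)
  have hq : g 0 * g 1 + g 2 * g 3 ≠ 0 := by
    have : X 0 * X 1 + X 2 * X 3 ≠ (0 : MvPolynomial (Fin 5) K) := by
      intro h
      have := congrArg (eval ![1, 1, 0, 0, 0]) h
      simp at this
    intro h
    apply this
    apply hinj
    simpa [g] using h
  obtain ⟨z, hz⟩ : ∃ z : T, z ^ 2 + g 4 * z + (g 0 * g 1 + g 2 * g 3) = 0 := by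
    obtain ⟨z, hz⟩ := IsAlgClosed.exists_root
      (Polynomial.C 1 * Polynomial.X ^ 2 + Polynomial.C (g 4) * Polynomial.X +
        Polynomial.C (g 0 * g 1 + g 2 * g 3))
      (by rw [Polynomial.degree_quadratic one_ne_zero]; norm_num)
    exact ⟨z, by simpa [Polynomial.IsRoot] using hz⟩
  have hz0 : z ≠ 0 := by
    rintro rfl
    exact hq (by simpa using hz)
  let φ : MvPolynomial (Fin 5) K →ₐ[K] MvPolynomial (Fin 6) K :=
    aeval ![X 0, X 3, X 1, X 4, X 2 - X 5]
  have h1 := aeval_eq_zero_of_aeval_generators K (g 0) (g 2) (z + g 4)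
    (g 1) (g 3) z hz0 (by linear_combination hz) (φ p) (by
      rw [← hp, ← AlgHom.comp_apply]
      congr 1
      apply MvPolynomial.algHom_ext
      intro i
      fin_cases i <;> simp [φ, toOmega_sub])
  have h2 : (aeval (R := K) ![g 0, g 2, z + g 4, g 1, g 3, z]).comp φ
      = IsScalarTower.toAlgHom K (MvPolynomial (Fin 5) K) T := by
    apply MvPolynomial.algHom_ext
    intro i
    fin_cases i <;> simp [φ, g]
  apply hinj
  rw [map_zero, ← h1, ← AlgHom.comp_apply, h2]
  rfl

theorem toOmega_zElt_notMem_adjoin_parameters [CharP K 2] :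
    toOmega K (zElt K) ∉ IntermediateField.adjoin K
      (Set.range ![toOmega K (uElt K), toOmega K (xElt K), toOmega K (vElt K), toOmega K (yElt K),
        toOmega K (wElt K - zElt K)]) := by
  rw [IntermediateField.mem_adjoin_range_iff]
  rintro ⟨r, s, hrs⟩
  have h2 : (2 : Omega K) = 0 := by
    rw [← map_ofNat (algebraMap K (Omega K)) 2, CharTwo.two_eq_zero, map_zero]
  let φ : MvPolynomial (Fin 5) K →ₐ[K] MvPolynomial (Fin 6) K :=
    aeval ![X 0, X 3, X 1, X 4, X 2 - X 5]
  have hφ (w z t : Omega K) (p) (ht : w - z = t) :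
      aeval ![toOmega K (uElt K), toOmega K (vElt K), w, toOmega K (xElt K),
        toOmega K (yElt K), z] (φ p) =
      aeval ![toOmega K (uElt K), toOmega K (xElt K), toOmega K (vElt K), toOmega K (yElt K), t]
        p := by
    rw [← AlgHom.comp_apply]
    congr 1
    apply MvPolynomial.algHom_ext
    intro i
    fin_cases i <;> simp [φ, ht]
  have hs : aeval ![toOmega K (uElt K), toOmega K (xElt K), toOmega K (vElt K),
      toOmega K (yElt K), toOmega K (wElt K - zElt K)] s ≠ 0 := by
    intro h
    rw [h, div_zero] at hrs
    exact toOmega_zElt_ne_zero K hrs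
  rw [eq_div_iff hs] at hrs
  have hswap := aeval_eq_zero_of_aeval_generators K (toOmega K (uElt K)) (toOmega K (vElt K))
    (toOmega K (zElt K)) (toOmega K (xElt K)) (toOmega K (yElt K)) (toOmega K (wElt K))
    (toOmega_wElt_ne_zero K) (by linear_combination toOmega_relation K) (X 5 * φ s - φ r) (by
      rw [map_sub, map_mul, hφ _ _ _ s (toOmega_sub K _ _).symm,
        hφ _ _ _ r (toOmega_sub K _ _).symm]
      simpa [sub_eq_zero] using hrs)
  have ht : toOmega K (zElt K) - toOmega K (wElt K) = toOmega K (wElt K - zElt K) := by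
    rw [toOmega_sub]
    linear_combination (toOmega K (zElt K) - toOmega K (wElt K)) * h2
  rw [map_sub, map_mul, hφ _ _ _ s ht, hφ _ _ _ r ht] at hswap
  simp only [aeval_X, Matrix.cons_val] at hswap
  rw [sub_eq_zero, ← hrs] at hswap
  exact toOmega_wElt_ne_zElt K (mul_right_cancel₀ hs hswap)

end LocalRing

section SquareRoots

variable {K E : Type*} [Field K] [CharP K 2] [Field E] [Algebra K E]

theorem notMem_adjoin_of_sq_eq (g : Fin 5 → E) (hg : AlgebraicIndependent K g) {s : E}
    (hs : s ^ 2 = g 0 * g 2 * g 1 * g 3) :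
    s ∉ IntermediateField.adjoin K (Set.range g) := by
  have h0 (i) : g i ≠ 0 := hg.ne_zero i
  have hs0 : s ≠ 0 := by
    rintro rfl
    simp [h0, eq_comm] at hs
  rw [IntermediateField.mem_adjoin_range_iff]
  rintro ⟨p, q, hpq⟩
  have hq : aeval g q ≠ 0 := by
    intro h
    rw [h, div_zero] at hpq
    exact hs0 hpq
  apply hq
  rw [eq_zero_of_sq_eq_sq_mul p q, map_zero]
  apply hg
  simp only [map_mul, map_pow, aeval_X, map_one]
  rw [← hs, hpq]
  field_simp

theorem notMem_sup_adjoin_of_sq_eq (g : Fin 5 → E) (hg : AlgebraicIndependent K g) {s a : E}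
    (hs : s ^ 2 = g 0 * g 2 * g 1 * g 3) (ha : a ^ 2 = g 0 * g 3 * g 4) :
    a ∉ IntermediateField.adjoin K (Set.range g) ⊔ IntermediateField.adjoin K {s} := by
  have h2 : (2 : E) = 0 := by
    rw [← map_ofNat (algebraMap K E) 2, CharTwo.two_eq_zero, map_zero]
  have key (f : E) (hf : f ∈ IntermediateField.adjoin K (Set.range g)) :
      ∃ p q : MvPolynomial (Fin 5) K, q ≠ 0 ∧ f * aeval g q = aeval g p := by
    rw [IntermediateField.mem_adjoin_range_iff] at hf
    obtain ⟨p, q, rfl⟩ := hf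
    by_cases hq : aeval g q = 0
    · exact ⟨0, 1, one_ne_zero, by simp [hq]⟩
    · exact ⟨p, q, fun h => hq (by rw [h, map_zero]), by field_simp⟩
  have hgmem (i) : g i ∈ IntermediateField.adjoin K (Set.range g) :=
    IntermediateField.subset_adjoin _ _ ⟨i, rfl⟩
  intro hmem
  obtain ⟨r, hr, t, ht, hrt⟩ := mem_sup_adjoin_quadratic _ (zero_mem _)
    (mul_mem (mul_mem (mul_mem (hgmem 0) (hgmem 2)) (hgmem 1)) (hgmem 3))
    (by rw [hs]; ring) hmem
  obtain ⟨p, q, hq, hpq⟩ := key r hr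
  obtain ⟨p', q', hq', hpq'⟩ := key t ht
  apply mul_ne_zero hq hq'
  apply eq_zero_of_sq_add_sq_mul_eq (p * q') (p' * q)
  apply hg
  simp only [map_mul, map_add, map_pow, aeval_X, map_one]
  rw [← hs, ← ha, hrt, ← hpq, ← hpq']
  linear_combination -(r * t * s * (aeval g q * aeval g q') ^ 2) * h2

end SquareRoots

section DegreeEight

open IntermediateField

variable {K E : Type*} [Field K] [CharP K 2] [Field E] [Algebra K E]

theorem eq_of_sq_eq_sq_of_two_eq_zero {p q : E} (h2 : (2 : E) = 0) (h : p ^ 2 = q ^ 2) :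
    p = q := by
  have h' : (p - q) ^ 2 = 0 := by linear_combination h + (q ^ 2 - p * q) * h2
  exact sub_eq_zero.mp (pow_eq_zero_iff two_ne_zero |>.mp h')

/-- The field generated by the coordinates of a point on the hypersurface and by the five square
roots arises from the parameter field by three successive quadratic extensions. -/
theorem relfinrank_parameters_eq_eight {u v w x y z a b c d e : E}
    (hrel : u * x + v * y + w * z = 0) (hw0 : w ≠ 0)
    (ha : a ^ 2 = u * y * z) (hb : b ^ 2 = v * x * z) (hc : c ^ 2 = w * x * y)
    (hd : d ^ 2 = u * v * w) (he : e ^ 2 = v * w * y * z)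
    (hind : AlgebraicIndependent K ![u, x, v, y, z])
    (hzF : z ∉ adjoin K {u, x, v, y, w - z}) :
    relfinrank (adjoin K {u, x, v, y, w - z})
      (adjoin K {u, v, w, x, y, z, a, b, c, d, e}) = 8 := by
  have h2 : (2 : E) = 0 := by
    rw [← map_ofNat (algebraMap K E) 2, CharTwo.two_eq_zero, map_zero]
  have hu0 : u ≠ 0 := hind.ne_zero 0
  have hx0 : x ≠ 0 := hind.ne_zero 1
  have hy0 : y ≠ 0 := hind.ne_zero 3
  have hz0 : z ≠ 0 := hind.ne_zero 4
  set M := adjoin K {u, v, w, x, y, z, a, b, c, d, e} with hM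
  set F := adjoin K {u, x, v, y, w - z} with hF
  have hMmem : ∀ t ∈ ({u, v, w, x, y, z, a, b, c, d, e} : Set E), t ∈ M :=
    fun t ht => subset_adjoin _ _ ht
  have hFmem : ∀ t ∈ ({u, x, v, y, w - z} : Set E), t ∈ F := fun t ht => subset_adjoin _ _ ht
  have huM : u ∈ M := hMmem _ (by simp)
  have hvM : v ∈ M := hMmem _ (by simp)
  have hwM : w ∈ M := hMmem _ (by simp)
  have hxM : x ∈ M := hMmem _ (by simp)
  have hyM : y ∈ M := hMmem _ (by simp)
  have hzM : z ∈ M := hMmem _ (by simp)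
  have haM : a ∈ M := hMmem _ (by simp)
  have hbM : b ∈ M := hMmem _ (by simp)
  have huF : u ∈ F := hFmem _ (by simp)
  have hxF : x ∈ F := hFmem _ (by simp)
  have hvF : v ∈ F := hFmem _ (by simp)
  have hyF : y ∈ F := hFmem _ (by simp)
  have htF : w - z ∈ F := hFmem _ (by simp)
  obtain ⟨s, hab⟩ : ∃ s, a * b = z * s := ⟨a * b / z, by field_simp⟩
  have hs2 : s ^ 2 = u * v * x * y := by
    have : z ^ 2 * s ^ 2 = z ^ 2 * (u * v * x * y) := by
      rw [← mul_pow, ← hab, mul_pow, ha, hb]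
      ring
    exact mul_left_cancel₀ (pow_ne_zero 2 hz0) this
  have ha0 : a ≠ 0 := by
    rintro rfl
    simp [hu0, hy0, hz0, eq_comm] at ha
  have hc0 : c ≠ 0 := by
    rintro rfl
    simp [hw0, hx0, hy0, eq_comm] at hc
  have hb' : b = z * s / a := by rw [eq_div_iff ha0]; linear_combination hab
  have he' : e = s + v * y := by
    apply eq_of_sq_eq_sq_of_two_eq_zero h2
    linear_combination he + v * y * hrel - hs2 - (s * v * y + v * y * (u * x + v * y)) * h2
  have hc' : c = y * (u * x + s) / a := by
    rw [eq_div_iff ha0]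
    apply eq_of_sq_eq_sq_of_two_eq_zero h2
    linear_combination a ^ 2 * hc + w * x * y * ha + u * x * y ^ 2 * hrel - y ^ 2 * hs2
      - y ^ 2 * u * x * (s + u * x + v * y) * h2
  have hd' : d = w * s / c := by
    rw [eq_div_iff hc0]
    apply eq_of_sq_eq_sq_of_two_eq_zero h2
    linear_combination c ^ 2 * hd + u * v * w * hc - w ^ 2 * hs2
  have hFM : F ≤ M := by
    rw [hF, adjoin_le_iff]
    rintro t (rfl | rfl | rfl | rfl | rfl)
    exacts [huM, hxM, hvM, hyM, sub_mem hwM hzM]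
  have hsM : s ∈ M := by
    rw [show s = a * b / z by rw [hab]; field_simp]
    exact div_mem (mul_mem haM hbM) hzM
  have hF1 : F ⊔ adjoin K {z} = adjoin K (Set.range ![u, x, v, y, z]) := by
    have hg (i) : ![u, x, v, y, z] i ∈ adjoin K (Set.range ![u, x, v, y, z]) :=
      subset_adjoin _ _ ⟨i, rfl⟩
    apply le_antisymm
    · rw [hF, sup_le_iff, adjoin_le_iff, adjoin_simple_le_iff]
      refine ⟨?_, hg 4⟩
      rintro t (rfl | rfl | rfl | rfl | rfl)
      · exact hg 0
      · exact hg 1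
      · exact hg 2
      · exact hg 3
      · have hw : w = (u * x + v * y) / z := by
          rw [eq_div_iff hz0]
          linear_combination hrel - (u * x + v * y) * h2
        rw [hw]
        exact sub_mem (div_mem (add_mem (mul_mem (hg 0) (hg 1)) (mul_mem (hg 2) (hg 3))) (hg 4))
          (hg 4)
    · rw [adjoin_le_iff]
      rintro _ ⟨i, rfl⟩
      have hle : F ≤ F ⊔ adjoin K {z} := le_sup_left
      fin_cases i
      exacts [hle huF, hle hxF, hle hvF, hle hyF,
        (le_sup_right : adjoin K {z} ≤ F ⊔ adjoin K {z}) (mem_adjoin_simple_self K z)]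
  have hs1 := notMem_adjoin_of_sq_eq _ hind
    (hs2.trans (by simp only [Matrix.cons_val]))
  have ha1 := notMem_sup_adjoin_of_sq_eq _ hind
    (hs2.trans (by simp only [Matrix.cons_val]))
    (ha.trans (by simp only [Matrix.cons_val]))
  rw [← hF1] at hs1 ha1
  set F1 := F ⊔ adjoin K {z} with hF1def
  set F2 := F1 ⊔ adjoin K {s} with hF2def
  set F3 := F2 ⊔ adjoin K {a} with hF3def
  have hF01 : F ≤ F1 := le_sup_left
  have hF12 : F1 ≤ F2 := le_sup_left
  have hF23 : F2 ≤ F3 := le_sup_left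
  have hz1 : z ∈ F1 := (le_sup_right : adjoin K {z} ≤ F1) (mem_adjoin_simple_self K z)
  have hs2' : s ∈ F2 := (le_sup_right : adjoin K {s} ≤ F2) (mem_adjoin_simple_self K s)
  have ha3 : a ∈ F3 := (le_sup_right : adjoin K {a} ≤ F3) (mem_adjoin_simple_self K a)
  have hr1 : relfinrank F F1 = 2 := relfinrank_sup_adjoin_quadratic F hzF htF
    (add_mem (mul_mem huF hxF) (mul_mem hvF hyF))
    (by linear_combination hrel - (u * x + v * y + (w - z) * z) * h2)
  have hr2 : relfinrank F1 F2 = 2 := relfinrank_sup_adjoin_quadratic F1 hs1 (zero_mem _)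
    (mul_mem (mul_mem (mul_mem (hF01 huF) (hF01 hvF)) (hF01 hxF)) (hF01 hyF))
    (by rw [hs2]; ring)
  have hr3 : relfinrank F2 F3 = 2 := relfinrank_sup_adjoin_quadratic F2 ha1 (zero_mem _)
    (mul_mem (mul_mem (hF12 (hF01 huF)) (hF12 (hF01 hyF))) (hF12 hz1))
    (by rw [ha]; ring)
  have hFM3 : F3 = M := by
    apply le_antisymm
    · rw [hF3def, hF2def, hF1def]
      simp only [sup_le_iff, adjoin_simple_le_iff]
      exact ⟨⟨⟨hFM, hzM⟩, hsM⟩, haM⟩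
    · have hF03 : F ≤ F3 := hF01.trans (hF12.trans hF23)
      have hz3 : z ∈ F3 := hF23 (hF12 hz1)
      have hs3 : s ∈ F3 := hF23 hs2'
      have hw3 : w ∈ F3 := by simpa using add_mem (hF03 htF) hz3
      have hc3 : c ∈ F3 := hc' ▸ div_mem
        (mul_mem (hF03 hyF) (add_mem (mul_mem (hF03 huF) (hF03 hxF)) hs3)) ha3
      rw [hM, adjoin_le_iff]
      rintro t (rfl | rfl | rfl | rfl | rfl | rfl | rfl | rfl | rfl | rfl | rfl)
      exacts [hF03 huF, hF03 hvF, hw3, hF03 hxF, hF03 hyF, hz3, ha3,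
        hb' ▸ div_mem (mul_mem hz3 hs3) ha3, hc3, hd' ▸ div_mem (mul_mem hw3 hs3) hc3,
        he' ▸ add_mem hs3 (mul_mem (hF03 hvF) (hF03 hyF))]
  rw [← hFM3, ← relfinrank_mul_relfinrank hF01 (hF12.trans hF23),
    ← relfinrank_mul_relfinrank hF12 hF23, hr1, hr2, hr3]

end DegreeEight

section FractionField

variable (K : Type) [Field K] [(mIdeal K).IsPrime] [IsDomain (Aring K)]

/-- The fraction field of `A[S]` is generated by the six coordinates and `S`. -/
theorem adjoin_coe_algebra_adjoin (S : Set (Omega K)) :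
    IntermediateField.adjoin K ((Algebra.adjoin (Aring K) S : Subalgebra (Aring K) (Omega K)) :
      Set (Omega K)) =
    IntermediateField.adjoin K ({toOmega K (uElt K), toOmega K (vElt K), toOmega K (wElt K),
      toOmega K (xElt K), toOmega K (yElt K), toOmega K (zElt K)} ∪ S) := by
  apply le_antisymm
  · rw [IntermediateField.adjoin_le_iff]
    set N := IntermediateField.adjoin K ({toOmega K (uElt K), toOmega K (vElt K),
      toOmega K (wElt K), toOmega K (xElt K), toOmega K (yElt K), toOmega K (zElt K)} ∪ S) with hN
    have hpoly (p : MvPolynomial (Fin 6) K) :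
        toOmega K (algebraMap (Bring K) (Aring K) (bMk K p)) ∈ N := by
      rw [← aeval_generators]
      refine (Algebra.adjoin_le (S := N.toSubalgebra) ?_)
        ((Algebra.adjoin_range_eq_range_aeval K _).ge ⟨p, rfl⟩)
      rintro _ ⟨i, rfl⟩
      apply IntermediateField.subset_adjoin
      fin_cases i <;> simp
    have hcoe (α : Aring K) : toOmega K α ∈ N := by
      obtain ⟨⟨r, s⟩, hrs⟩ := IsLocalization.surj (mIdeal K).primeCompl α
      obtain ⟨p, rfl⟩ : ∃ p, bMk K p = r := Ideal.Quotient.mk_surjective r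
      obtain ⟨q, hq⟩ : ∃ q, bMk K q = s := Ideal.Quotient.mk_surjective (s : Bring K)
      have hne : toOmega K (algebraMap (Bring K) (Aring K) s) ≠ 0 := by
        rw [Ne, ← map_zero (algebraMap (Aring K) (Omega K))]
        exact (toOmega_injective K).ne (IsLocalization.map_units (Aring K) s).ne_zero
      have hdiv : toOmega K α = toOmega K (algebraMap (Bring K) (Aring K) (bMk K p)) /
          toOmega K (algebraMap (Bring K) (Aring K) s) := by
        rw [eq_div_iff hne, ← toOmega_mul, hrs]
      rw [hdiv]
      exact div_mem (hpoly p) (hq ▸ hpoly q)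
    intro t ht
    induction ht using Algebra.adjoin_induction with
    | mem t ht => exact IntermediateField.subset_adjoin _ _ (Or.inr ht)
    | algebraMap α => exact hcoe α
    | add p q _ _ hp hq => exact add_mem hp hq
    | mul p q _ _ hp hq => exact mul_mem hp hq
  · apply IntermediateField.adjoin.mono
    apply Set.union_subset
    · rintro t (rfl | rfl | rfl | rfl | rfl | rfl) <;> exact Subalgebra.algebraMap_mem _ _
    · exact Algebra.subset_adjoin

end FractionField

/-- The five elements `u, x, v, y, w−z` of `R = A[a,b,c,d,e]` are
algebraically independent over `K`, and the fraction field of `R` (the smallest subfield of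
`Ω` containing `R`, namely the intermediate field generated by `R` over `K`) is an extension
of degree `8` of the subfield `K(u, x, v, y, w−z)` of `Ω`. -/
theorem adjoined_ring_degree_eight_over_parameter_field
    (K : Type) [Field K] [CharP K 2] [(mIdeal K).IsPrime] [IsDomain (Aring K)]
    (a b c d e : Omega K)
    (ha : a ^ 2 = toOmega K (uElt K * yElt K * zElt K))
    (hb : b ^ 2 = toOmega K (vElt K * xElt K * zElt K))
    (hc : c ^ 2 = toOmega K (wElt K * xElt K * yElt K))
    (hd : d ^ 2 = toOmega K (uElt K * vElt K * wElt K))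
    (he : e ^ 2 = toOmega K (vElt K * wElt K * yElt K * zElt K)) :
    AlgebraicIndependent K
      ![toOmega K (uElt K), toOmega K (xElt K), toOmega K (vElt K), toOmega K (yElt K),
        toOmega K (wElt K - zElt K)] ∧
    ∃ hle : IntermediateField.adjoin K
        ({toOmega K (uElt K), toOmega K (xElt K), toOmega K (vElt K), toOmega K (yElt K),
          toOmega K (wElt K - zElt K)} : Set (Omega K)) ≤
        IntermediateField.adjoin K
          ((Algebra.adjoin (Aring K) ({a, b, c, d, e} : Set (Omega K))) : Set (Omega K)),
      Module.finrank
        (IntermediateField.adjoin K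
          ({toOmega K (uElt K), toOmega K (xElt K), toOmega K (vElt K), toOmega K (yElt K),
            toOmega K (wElt K - zElt K)} : Set (Omega K)))
        (IntermediateField.extendScalars hle) = 8 := by
  refine ⟨algebraicIndependent_parameters K, ?_⟩
  have hM := adjoin_coe_algebra_adjoin K {a, b, c, d, e}
  simp only [Set.insert_union, Set.singleton_union] at hM
  have hzF := toOmega_zElt_notMem_adjoin_parameters K
  simp only [Matrix.range_cons, Matrix.range_empty, Set.union_empty, Set.singleton_union] at hzF
  have hle : IntermediateField.adjoin K
      ({toOmega K (uElt K), toOmega K (xElt K), toOmega K (vElt K), toOmega K (yElt K),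
        toOmega K (wElt K - zElt K)} : Set (Omega K)) ≤
      IntermediateField.adjoin K
        ((Algebra.adjoin (Aring K) ({a, b, c, d, e} : Set (Omega K))) : Set (Omega K)) := by
    apply IntermediateField.adjoin.mono
    rintro t (rfl | rfl | rfl | rfl | rfl) <;> exact Subalgebra.algebraMap_mem _ _
  refine ⟨hle, ?_⟩
  rw [← IntermediateField.relfinrank_eq_finrank_of_le, hM]
  simp only [toOmega_mul, toOmega_sub] at *
  exact relfinrank_parameters_eq_eight (toOmega_relation K) (toOmega_wElt_ne_zero K) ha hb hc hd he
    (algebraicIndependent_coordinates K) hzF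
end
end
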